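/- arXiv:2412.14811 — 11 statements merged into one kernel-verified Lean document; each statement's English description precedes it below -/
import Mathlib

section
/- Let N ≥ 3 be odd, let q ∈ ℂ be a primitive N-th root of unity, and let X be an invertible N×N complex matrix with X^N = 1. Set χ := X⁻¹ ⊗ X (Kronecker product, an N²×N² matrix) and 𝒪 := ∑_{n=0}^{N-1} q^{-n²} χ^n. Then 𝒪 is invertible, and moreover there exist b₀,…,b_{N−1} ∈ ℂ such that (∑_{n=0}^{N-1} b_n χ^n)·𝒪 = 𝒪·(∑_{n=0}^{N-1} b_n χ^n) = 1. -/
open Matrix Kronecker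

theorem sum_range_add_of_periodic {M : Type*} [AddCommGroup M] {f : ℕ → M} {N : ℕ}
    (hf : Function.Periodic f N) (j : ℕ) :
    ∑ m ∈ Finset.range N, f (m + j) = ∑ m ∈ Finset.range N, f m := by
  induction j with
  | zero => simp
  | succ j ih =>
    have h := (Finset.sum_range_succ (fun m => f (m + j)) N).symm.trans
      (Finset.sum_range_succ' (fun m => f (m + j)) N)
    have hN : f (N + j) = f (0 + j) := by rw [add_comm N j, hf j, zero_add]
    rw [hN, add_left_inj, ih] at h
    rw [h]
    exact Finset.sum_congr rfl fun m _ => by congr 1; ring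

theorem IsPrimitiveRoot.sum_zpow_neg_two_mul {K : Type*} [Field K] {q : K} {N : ℕ}
    (hq : IsPrimitiveRoot q N) (hN : Odd N) {k : ℕ} (hk : k < N) :
    ∑ n ∈ Finset.range N, q ^ (-(2 * (k : ℤ) * n)) = if k = 0 then (N : K) else 0 := by
  split_ifs with h0
  · simp [h0]
  · have h1 : q ^ (-(2 * (k : ℤ))) ≠ 1 := by
      rw [Ne, hq.zpow_eq_one_iff_dvd, dvd_neg]
      intro h
      have h2 : N ∣ 2 * k := by exact_mod_cast h
      exact h0 (Nat.eq_zero_of_dvd_of_lt (hN.coprime_two_right.dvd_of_dvd_mul_left h2) hk)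
    have hpow : (q ^ (-(2 * (k : ℤ)))) ^ N = 1 := by
      rw [← zpow_natCast, ← _root_.zpow_mul, hq.zpow_eq_one_iff_dvd]
      exact dvd_mul_left _ _
    have h := geom_sum_eq h1 N
    rw [hpow, sub_self, zero_div] at h
    rw [← h]
    refine Finset.sum_congr rfl fun n _ => ?_
    rw [← zpow_natCast, ← _root_.zpow_mul, neg_mul]

theorem IsPrimitiveRoot.sum_zpow_sq_smul_pow_mul {K A : Type*} [Field K] [Ring A] [Algebra K A]
    {q : K} {N : ℕ} (hq : IsPrimitiveRoot q N) (hN : Odd N) {x : A} (hx : x ^ N = 1) :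
    (∑ m ∈ Finset.range N, q ^ ((m : ℤ) ^ 2) • x ^ m) *
      (∑ n ∈ Finset.range N, q ^ (-((n : ℤ) ^ 2)) • x ^ n) = (N : K) • 1 := by
  have hq0 : q ≠ 0 := hq.ne_zero hN.pos.ne'
  have hper (n : ℕ) : Function.Periodic
      (fun k : ℕ => q ^ ((k : ℤ) ^ 2 - 2 * k * n) • x ^ k) N := by
    intro k
    have e : (((k + N : ℕ) : ℤ) ^ 2 - 2 * (k + N : ℕ) * n)
        = ((k : ℤ) ^ 2 - 2 * k * n) + N * (2 * k + N - 2 * n) := by push_cast; ring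
    have hqN : q ^ ((N : ℤ) * (2 * k + N - 2 * n)) = 1 :=
      (hq.zpow_eq_one_iff_dvd _).2 (dvd_mul_right _ _)
    simp only
    rw [e, zpow_add₀ hq0, hqN, mul_one, pow_add, hx, mul_one]
  calc
    _ = ∑ n ∈ Finset.range N, ∑ m ∈ Finset.range N,
        q ^ (((m + n : ℕ) : ℤ) ^ 2 - 2 * (m + n : ℕ) * n) • x ^ (m + n) := by
      rw [Finset.sum_mul_sum, Finset.sum_comm]
      refine Finset.sum_congr rfl fun n _ => Finset.sum_congr rfl fun m _ => ?_
      rw [smul_mul_smul_comm, ← zpow_add₀ hq0, ← pow_add]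
      congr 2
      push_cast
      ring
    _ = ∑ n ∈ Finset.range N, ∑ k ∈ Finset.range N,
        q ^ ((k : ℤ) ^ 2 - 2 * k * n) • x ^ k :=
      Finset.sum_congr rfl fun n _ => sum_range_add_of_periodic (hper n) n
    _ = ∑ k ∈ Finset.range N, (q ^ ((k : ℤ) ^ 2) * if k = 0 then (N : K) else 0) • x ^ k := by
      rw [Finset.sum_comm]
      refine Finset.sum_congr rfl fun k hk => ?_
      rw [← hq.sum_zpow_neg_two_mul hN (Finset.mem_range.1 hk), Finset.mul_sum, Finset.sum_smul]
      refine Finset.sum_congr rfl fun n _ => ?_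
      rw [← zpow_add₀ hq0, sub_eq_add_neg]
    _ = (N : K) • 1 := by
      rw [Finset.sum_eq_single_of_mem 0 (Finset.mem_range.2 hN.pos)]
      · simp
      · intro k _ hk
        simp [hk]

theorem Matrix.kronecker_pow {R m n : Type*} [CommSemiring R] [Fintype m] [Fintype n]
    [DecidableEq m] [DecidableEq n] (A : Matrix m m R) (B : Matrix n n R) (k : ℕ) :
    (A ⊗ₖ B) ^ k = (A ^ k) ⊗ₖ (B ^ k) := by
  induction k with
  | zero => simp
  | succ k ih => rw [pow_succ, pow_succ, pow_succ, ih, mul_kronecker_mul]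

/-- The operator `𝒪(χ) = ∑ q^{-n²} χⁿ`, `χ = X⁻¹ ⊗ X`, is invertible at `q` a primitive
`N`-th root of unity, with inverse a polynomial of degree `< N` in `χ`. -/
theorem stmt_1 (N : ℕ) (hN : 3 ≤ N) (hNodd : Odd N)
    (q : ℂ) (hq : IsPrimitiveRoot q N)
    (X : Matrix (Fin N) (Fin N) ℂ) (hXu : IsUnit X) (hXN : X ^ N = 1) :
    IsUnit (∑ n ∈ Finset.range N, q ^ (-((n : ℤ) ^ 2)) • (X⁻¹ ⊗ₖ X) ^ n) ∧
    ∃ b : Fin N → ℂ,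
      (∑ n : Fin N, b n • (X⁻¹ ⊗ₖ X) ^ (n : ℕ)) *
          (∑ n ∈ Finset.range N, q ^ (-((n : ℤ) ^ 2)) • (X⁻¹ ⊗ₖ X) ^ n) = 1 ∧
      (∑ n ∈ Finset.range N, q ^ (-((n : ℤ) ^ 2)) • (X⁻¹ ⊗ₖ X) ^ n) *
          (∑ n : Fin N, b n • (X⁻¹ ⊗ₖ X) ^ (n : ℕ)) = 1 := by
  have hχ : (X⁻¹ ⊗ₖ X) ^ N = 1 := by
    rw [Matrix.kronecker_pow, Matrix.inv_pow', hXN, inv_one, one_kronecker_one]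
  have hN0 : (N : ℂ) ≠ 0 := Nat.cast_ne_zero.2 (by omega)
  have hinv : (∑ n : Fin N, ((N : ℂ)⁻¹ * q ^ (((n : ℕ) : ℤ) ^ 2)) • (X⁻¹ ⊗ₖ X) ^ (n : ℕ)) *
      (∑ n ∈ Finset.range N, q ^ (-((n : ℤ) ^ 2)) • (X⁻¹ ⊗ₖ X) ^ n) = 1 := by
    rw [Fin.sum_univ_eq_sum_range
      (fun n : ℕ => ((N : ℂ)⁻¹ * q ^ ((n : ℤ) ^ 2)) • (X⁻¹ ⊗ₖ X) ^ n) N]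
    simp only [mul_smul]
    rw [← Finset.smul_sum, smul_mul_assoc, hq.sum_zpow_sq_smul_pow_mul hNodd hχ,
      inv_smul_smul₀ hN0]
  have hinv' := mul_eq_one_comm.1 hinv
  exact ⟨IsUnit.of_mul_eq_one _ hinv', _, hinv, hinv'⟩
end

section
/- Let N ≥ 3 be odd, q ∈ ℂ a primitive N-th root of unity, and x_r, y_r, μ_r, x_s, y_s, μ_s ∈ ℂ. (a) If Ŵ : ZMod N → ℂ satisfies (μ_s x_s − μ_r x_r q^{2n})·Ŵ(n) = (μ_s y_r − μ_r y_s q^{2(n−1)})·Ŵ(n−1) for every n ∈ ZMod N, then its discrete Fourier transform W(n) := ∑_{m ∈ ZMod N} Ŵ(m) q^{−2mn} satisfies μ_s (y_r − x_s q^{2n})·W(n) = μ_r (y_s − x_r q^{2n})·W(n−1) for every n ∈ ZMod N. (b) If W̄ : ZMod N → ℂ satisfies (y_s − y_r q^{2n})·W̄(n) = μ_r μ_s (x_r q² − x_s q^{2n})·W̄(n−1) for every n ∈ ZMod N, then W̌(n) := ∑_{m ∈ ZMod N} W̄(m) q^{2mn} satisfies (y_r − x_s μ_r μ_s q^{2n})·W̌(n)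 = (y_s − x_r μ_r μ_s q^{2n})·W̌(n−1) for every n ∈ ZMod N. -/
theorem pow_val_add_of_pow_eq_one {M : Type*} [Monoid M] {N : ℕ} [NeZero N] {Q : M}
    (hQ : Q ^ N = 1) (a b : ZMod N) : Q ^ (a + b).val = Q ^ a.val * Q ^ b.val := by
  rw [ZMod.val_add, ← pow_add, ← pow_eq_pow_mod _ hQ]

theorem sum_mul_eq_of_recursion {G R : Type*} [AddGroup G] [Fintype G] [CommRing R]
    {A B W : G → R} {g : G} (h : ∀ m, A m * W m = B m * W (m - g)) (f : G → R) :
    ∑ m, A m * W m * f m = ∑ m, B (m + g) * W m * f (m + g) := by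
  rw [← Equiv.sum_comp (Equiv.addRight g) fun m => A m * W m * f m]
  refine Finset.sum_congr rfl fun m _ => ?_
  simp only [Equiv.coe_addRight, h, add_sub_cancel_right]

/-- Discrete Fourier transforms of the chiral Potts Boltzmann weights satisfy the
transformed recursion relations (eq:WFTRR1) and (eq:WFTRR2) of the paper. -/
theorem stmt_2 (N : ℕ) [NeZero N] (hN : 3 ≤ N) (hNodd : Odd N)
    (q : ℂ) (hq : IsPrimitiveRoot q N)
    (xr yr μr xs ys μs : ℂ) :
    -- (a)
    (∀ What : ZMod N → ℂ,
      (∀ n : ZMod N,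
        (μs * xs - μr * xr * (q ^ 2) ^ n.val) * What n
          = (μs * yr - μr * ys * (q ^ 2) ^ (n - 1).val) * What (n - 1)) →
      ∀ n : ZMod N,
        μs * (yr - xs * (q ^ 2) ^ n.val) *
            (∑ m : ZMod N, What m * ((q ^ 2) ^ (m * n).val)⁻¹)
          = μr * (ys - xr * (q ^ 2) ^ n.val) *
            (∑ m : ZMod N, What m * ((q ^ 2) ^ (m * (n - 1)).val)⁻¹))
    ∧
    -- (b)
    (∀ Wbar : ZMod N → ℂ,
      (∀ n : ZMod N,
        (ys - yr * (q ^ 2) ^ n.val) * Wbar n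
          = μr * μs * (xr * q ^ 2 - xs * (q ^ 2) ^ n.val) * Wbar (n - 1)) →
      ∀ n : ZMod N,
        (yr - xs * μr * μs * (q ^ 2) ^ n.val) *
            (∑ m : ZMod N, Wbar m * (q ^ 2) ^ (m * n).val)
          = (ys - xr * μr * μs * (q ^ 2) ^ n.val) *
            (∑ m : ZMod N, Wbar m * (q ^ 2) ^ (m * (n - 1)).val)) := by
  have hQ : (q ^ 2) ^ N = 1 := by rw [← pow_mul, mul_comm, pow_mul, hq.pow_eq_one, one_pow]
  have hne (a : ZMod N) : (q ^ 2) ^ a.val ≠ 0 :=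
    pow_ne_zero _ (pow_ne_zero _ (hq.ne_zero (NeZero.ne N)))
  have hone : (q ^ 2) ^ (1 : ZMod N).val = q ^ 2 := by
    rw [ZMod.val_one'' (by omega), pow_one]
  have hadd := pow_val_add_of_pow_eq_one hQ
  generalize he : (fun a : ZMod N => (q ^ 2) ^ a.val) = e
  have he' (a : ZMod N) : (q ^ 2) ^ a.val = e a := by rw [← he]
  simp only [he'] at hne hone hadd ⊢
  have hsub (m n : ZMod N) : e (m * n) = e (m * (n - 1)) * e m := by
    rw [← hadd]; congr 1; ring
  refine ⟨fun W h n => ?_, fun W h n => ?_⟩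
  · have key := sum_mul_eq_of_recursion (A := fun m => μs * xs - μr * xr * e m)
      (B := fun m => μs * yr - μr * ys * e (m - 1)) h fun m => (e (m * n))⁻¹
    have hl : ∑ m, (μs * xs - μr * xr * e m) * W m * (e (m * n))⁻¹
        = μs * xs * ∑ m, W m * (e (m * n))⁻¹
          - μr * xr * ∑ m, W m * (e (m * (n - 1)))⁻¹ := by
      rw [Finset.mul_sum, Finset.mul_sum, ← Finset.sum_sub_distrib]
      refine Finset.sum_congr rfl fun m _ => ?_
      rw [hsub m n]
      have h1 := hne m
      have h2 := hne (m * (n - 1))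
      field_simp
    have hr : e n * ∑ m, (μs * yr - μr * ys * e (m + 1 - 1)) * W m * (e ((m + 1) * n))⁻¹
        = μs * yr * ∑ m, W m * (e (m * n))⁻¹
          - μr * ys * ∑ m, W m * (e (m * (n - 1)))⁻¹ := by
      rw [Finset.mul_sum, Finset.mul_sum, Finset.mul_sum, ← Finset.sum_sub_distrib]
      refine Finset.sum_congr rfl fun m _ => ?_
      rw [add_sub_cancel_right, add_mul, one_mul, hadd, hsub m n]
      have h1 := hne m
      have h2 := hne (m * (n - 1))
      have h3 := hne n
      field_simp
    linear_combination e n * hl - e n * key - hr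
  · have key := sum_mul_eq_of_recursion (A := fun m => ys - yr * e m)
      (B := fun m => μr * μs * (xr * q ^ 2 - xs * e m)) h fun m => e (m * (n - 1))
    have hl : ∑ m, (ys - yr * e m) * W m * e (m * (n - 1))
        = ys * ∑ m, W m * e (m * (n - 1)) - yr * ∑ m, W m * e (m * n) := by
      rw [Finset.mul_sum, Finset.mul_sum, ← Finset.sum_sub_distrib]
      refine Finset.sum_congr rfl fun m _ => ?_
      rw [hsub m n]
      ring
    have hr : ∑ m, μr * μs * (xr * q ^ 2 - xs * e (m + 1)) * W m * e ((m + 1) * (n - 1))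
        = μr * μs * e n * (xr * ∑ m, W m * e (m * (n - 1)) - xs * ∑ m, W m * e (m * n)) := by
      rw [Finset.mul_sum, Finset.mul_sum, ← Finset.sum_sub_distrib, Finset.mul_sum]
      refine Finset.sum_congr rfl fun m _ => ?_
      have hn : e n = e (n - 1) * q ^ 2 := by rw [← hone, ← hadd, sub_add_cancel]
      rw [add_mul, one_mul, hadd, hadd, hone, hsub m n, hn]
      ring
    linear_combination hl - key - hr
end

section
/- Let N ≥ 3 be odd, q ∈ ℂ a primitive N-th root of unity, and let Z be an invertible N×N complex matrix with Z^N = 1. Let x_r, y_r, μ_r, x_s, y_s, μ_s ∈ ℂ and suppose W̄ : ZMod N → ℂ satisfies (y_s − y_r q^{2n})·W̄(n) = μ_r μ_s (x_r q² − x_s q^{2n})·W̄(n−1) for every n ∈ ZMod N. Set T := ∑_{n=0}^{N-1} W̄(n) Z^{2n}. Then for every invertible N×N matrix X with Z·X = q·X·Z one has T·(y_r·1 − x_s μ_r μ_s Z²)·X = (y_s·1 − x_r μ_r μ_s Z²)·X·T. -/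
open Matrix

theorem pow_val_add_one {M : Type*} [Monoid M] {N : ℕ} [NeZero N] (hN : 1 < N) {a : M}
    (ha : a ^ N = 1) (n : ZMod N) : a ^ (n + 1).val = a ^ n.val * a := by
  have : Fact (1 < N) := ⟨hN⟩
  rw [ZMod.val_add, ZMod.val_one, ← pow_eq_pow_mod _ ha, pow_succ]

theorem pow_mul_of_mul_eq_smul_mul {R A : Type*} [CommSemiring R] [Semiring A] [Algebra R A]
    {r : R} {z x : A} (h : z * x = r • (x * z)) (k : ℕ) :
    z ^ k * x = r ^ k • (x * z ^ k) := by
  induction k with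
  | zero => simp
  | succ k ih =>
    rw [pow_succ, mul_assoc, h, mul_smul_comm, ← mul_assoc, ih, smul_mul_assoc, smul_smul,
      mul_assoc, pow_succ, mul_comm]

theorem sum_smul_pow_val_mul {R A : Type*} [CommSemiring R] [Semiring A] [Algebra R A]
    {N : ℕ} [NeZero N] (hN : 1 < N) {a : A} (ha : a ^ N = 1) (c : ZMod N → R) :
    (∑ n : ZMod N, c n • a ^ n.val) * a = ∑ n : ZMod N, c (n - 1) • a ^ n.val := by
  rw [← Equiv.sum_comp (Equiv.addRight (1 : ZMod N)) (fun n => c (n - 1) • a ^ n.val),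
    Finset.sum_mul]
  refine Finset.sum_congr rfl fun n _ => ?_
  simp [pow_val_add_one hN ha]

/-- The defining intertwining identity (eq:Trscond) for `T_{rs} = ∑ W̄_{rs}(n) Z^{2n}`,
which follows from the recursion (eq:WRR) for the chiral Potts weights. -/
theorem stmt_3 (N : ℕ) [NeZero N] (hN : 3 ≤ N) (hNodd : Odd N)
    (q : ℂ) (hq : IsPrimitiveRoot q N)
    (Z : Matrix (Fin N) (Fin N) ℂ) (hZu : IsUnit Z) (hZN : Z ^ N = 1)
    (xr yr μr xs ys μs : ℂ) (Wbar : ZMod N → ℂ)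
    (hrec : ∀ n : ZMod N,
      (ys - yr * (q ^ 2) ^ n.val) * Wbar n
        = μr * μs * (xr * q ^ 2 - xs * (q ^ 2) ^ n.val) * Wbar (n - 1)) :
    ∀ X : Matrix (Fin N) (Fin N) ℂ, IsUnit X → Z * X = q • (X * Z) →
      (∑ n : ZMod N, Wbar n • Z ^ (2 * n.val)) *
          (yr • (1 : Matrix (Fin N) (Fin N) ℂ) - (xs * μr * μs) • Z ^ 2) * X
        = (ys • (1 : Matrix (Fin N) (Fin N) ℂ) - (xr * μr * μs) • Z ^ 2) * X *
          (∑ n : ZMod N, Wbar n • Z ^ (2 * n.val)) := by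
  intro X _ hX
  have h1 : 1 < N := by lia
  have hqN : (q ^ 2) ^ N = 1 := by rw [← pow_mul, mul_comm, pow_mul, hq.pow_eq_one, one_pow]
  have hYN : (Z ^ 2) ^ N = 1 := by rw [← pow_mul, mul_comm, pow_mul, hZN, one_pow]
  have hY := pow_mul_of_mul_eq_smul_mul hX 2
  simp only [pow_mul]
  generalize Z ^ 2 = Y at *
  generalize q ^ 2 = t at *
  set T := ∑ n : ZMod N, Wbar n • Y ^ n.val with hT
  set S := ∑ n : ZMod N, (Wbar n * t ^ n.val) • Y ^ n.val with hS
  have hTX : T * X = X * S := by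
    rw [hT, hS, Finset.sum_mul, Finset.mul_sum]
    refine Finset.sum_congr rfl fun n _ => ?_
    rw [smul_mul_assoc, pow_mul_of_mul_eq_smul_mul hY, smul_smul, mul_smul_comm]
  have hYT : Y * T = T * Y := by
    rw [hT, Finset.sum_mul, Finset.mul_sum]
    refine Finset.sum_congr rfl fun n _ => ?_
    rw [smul_mul_assoc, mul_smul_comm, ← pow_succ, ← pow_succ']
  have key : yr • S - (xs * μr * μs * t) • (S * Y) = ys • T - (xr * μr * μs * t) • (T * Y) := by
    rw [hS, hT, sum_smul_pow_val_mul h1 hYN, sum_smul_pow_val_mul h1 hYN]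
    simp only [Finset.smul_sum, smul_smul, ← Finset.sum_sub_distrib, ← sub_smul]
    refine Finset.sum_congr rfl fun n _ => ?_
    congr 1
    have ht := pow_val_add_one h1 hqN (n - 1)
    rw [sub_add_cancel] at ht
    linear_combination (-1 : ℂ) * hrec n + xs * μr * μs * Wbar (n - 1) * ht
  calc T * (yr • (1 : Matrix (Fin N) (Fin N) ℂ) - (xs * μr * μs) • Y) * X
      = yr • (T * X) - (xs * μr * μs) • (T * (Y * X)) := by
        simp [mul_sub, sub_mul, mul_assoc]
    _ = X * (yr • S - (xs * μr * μs * t) • (S * Y)) := by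
        rw [hY, mul_smul_comm, ← mul_assoc, hTX, smul_smul]
        simp [mul_sub, mul_assoc]
    _ = X * (ys • T - (xr * μr * μs * t) • (Y * T)) := by rw [key, hYT]
    _ = ys • (X * T) - (xr * μr * μs) • (Y * X * T) := by
        rw [hY, smul_mul_assoc, smul_smul, mul_sub, mul_smul_comm, mul_smul_comm,
          mul_assoc X]
    _ = (ys • (1 : Matrix (Fin N) (Fin N) ℂ) - (xr * μr * μs) • Y) * X * T := by
        simp [sub_mul]
end

section
/- Let N ≥ 3 be odd, q ∈ ℂ a primitive N-th root of unity, and let X, Z be invertible N×N complex matrices with Z·X = q·X·Z and X^N = Z^N = 1. Let x_r, y_r, μ_r, x_s, y_s, μ_s, κ₀, κ₁ be nonzero complex numbers and let c₀ ∈ ℂ satisfy c₀² = q² x_r x_s / (y_r y_s). Define N×N matrices: Ω(e₀) := (κ₀ x_r/(q−q⁻¹))·X⁻¹·((y_s/(x_r μ_r μ_s))·Z⁻² − 1), Ω(e₁) := (κ₁ y_r/(q−q⁻¹))·((x_s μ_r μ_s/y_r)·Z² − 1)·X, Ω(t₀) := (c₀ y_r y_s/(q² x_r x_s μ_r μ_s))·Z⁻²,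 Ω(t₁) := Ω(t₀)⁻¹; φ(t₀) := (c₀/q)·Z⁻², φ(t₁) := (q/c₀)·Z²; ρ(e₀) := −(κ₀ x_r/(q−q⁻¹))·X⁻¹, ρ(e₁) := −(κ₁ y_r/(q−q⁻¹))·X, ρ(t₀) := (q μ_r)⁻¹·Z⁻², ρ(t₁) := q μ_r·Z²; ρ̄(e₀) := (κ₀ y_s/(μ_s(q−q⁻¹)))·X⁻¹, ρ̄(e₁) := (κ₁ x_s μ_s/(q−q⁻¹))·X, ρ̄(t₀) := μ_s⁻¹·Z⁻², ρ̄(t₁) := μ_s·Z². Set χ := X⁻¹ ⊗ X and 𝒪 := ∑_{n=0}^{N-1} q^{-n²} χ^n. Then 𝒪 is invertible and the following four identities hold in the N²×N² matrices: 𝒪·(Ω(e₀) ⊗ 1) = (ρ(e₀) ⊗ 1 + ρ(t₀) ⊗ ρ̄(e₀))·𝒪; 𝒪·(Ω(e₁) ⊗ 1) = (ρ(e₁) ⊗ 1 + ρ(t₁) ⊗ ρ̄(e₁))·𝒪; 𝒪·(Ω(t₀) ⊗ φ(t₀)) = (ρ(t₀) ⊗ ρ̄(t₀))·𝒪; 𝒪·(Ω(t₁)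 ⊗ φ(t₁)) = (ρ(t₁) ⊗ ρ̄(t₁))·𝒪. -/
open Matrix Kronecker

/-- The sum of an `N`-periodic sequence over a period is invariant under shifts. -/
lemma Function.Periodic.sum_range_add {M : Type*} [AddCommGroup M] {N : ℕ} {f : ℕ → M}
    (hf : Function.Periodic f N) (k : ℕ) :
    ∑ n ∈ Finset.range N, f (n + k) = ∑ n ∈ Finset.range N, f n := by
  induction k with
  | zero => simp
  | succ k ih =>
    have h := (Finset.sum_range_succ (fun n ↦ f (n + k)) N).symm.trans
      (Finset.sum_range_succ' (fun n ↦ f (n + k)) N)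
    rw [add_comm N k, hf k, zero_add] at h
    rw [← ih, add_right_cancel h]
    exact Finset.sum_congr rfl fun n _ ↦ by congr 1; ring

lemma zpow_eq_zpow_of_dvd_sub {q : ℂ} {N : ℕ} (hq0 : q ≠ 0) (hqN : q ^ N = 1) {a b : ℤ}
    (h : (N : ℤ) ∣ a - b) : q ^ a = q ^ b := by
  obtain ⟨k, hk⟩ := h
  rw [show a = N * k + b by linarith, zpow_add₀ hq0, _root_.zpow_mul, zpow_natCast, hqN,
    _root_.one_zpow, one_mul]

section ThetaSum

variable {A : Type*} [Ring A] [Algebra ℂ A] {N : ℕ} {q : ℂ} {c T : A}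

/-- The truncated theta series `∑_{n < N} q^{-n²} cⁿ`. -/
noncomputable def thetaSum (N : ℕ) (q : ℂ) (c : A) : A :=
  ∑ n ∈ Finset.range N, q ^ (-((n : ℤ) ^ 2)) • c ^ n

lemma Commute.thetaSum_right (h : Commute T c) : Commute T (thetaSum N q c) :=
  Commute.sum_right _ _ _ fun n _ ↦ (h.pow_right n).smul_right _

lemma periodic_zpow_sq_smul_pow (hq0 : q ≠ 0) (hqN : q ^ N = 1) (hc : c ^ N = 1) (e k : ℤ) :
    Function.Periodic (fun n : ℕ ↦ q ^ (e * ((n : ℤ) + k) ^ 2) • c ^ n) N := by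
  intro n
  dsimp only
  rw [pow_add, hc, mul_one]
  congr 1
  refine zpow_eq_zpow_of_dvd_sub hq0 hqN ⟨e * (2 * n + N + 2 * k), ?_⟩
  push_cast
  ring

lemma mul_pow_eq_smul {r : ℂ} (h : T * c = r • (c * T)) (n : ℕ) :
    T * c ^ n = r ^ n • (c ^ n * T) := by
  induction n with
  | zero => simp
  | succ n ih =>
    rw [pow_succ, ← mul_assoc, ih, smul_mul_assoc, mul_assoc, h, mul_smul_comm, smul_smul,
      ← pow_succ, ← mul_assoc]

lemma mul_thetaSum_of_sq (hq0 : q ≠ 0) (hqN : q ^ N = 1) (hc : c ^ N = 1)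
    (h : T * c = (q ^ 2) • (c * T)) :
    T * thetaSum N q c = q • (thetaSum N q c * c * T) := by
  have hs := (periodic_zpow_sq_smul_pow hq0 hqN hc (-1) (-1)).sum_range_add 1
  have h1 : thetaSum N q c * c = ∑ n ∈ Finset.range N,
      q ^ (-1 * ((n : ℤ) + -1) ^ 2) • c ^ n := by
    rw [← hs, thetaSum, Finset.sum_mul]
    refine Finset.sum_congr rfl fun n _ ↦ ?_
    rw [smul_mul_assoc, ← pow_succ]
    congr 2
    push_cast
    ring
  rw [h1, thetaSum, Finset.mul_sum, Finset.sum_mul, Finset.smul_sum]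
  refine Finset.sum_congr rfl fun n _ ↦ ?_
  rw [mul_smul_comm, mul_pow_eq_smul h, smul_mul_assoc, smul_smul, smul_smul, ← pow_mul,
    ← zpow_natCast, ← zpow_add₀ hq0, ← zpow_one_add₀ hq0]
  congr 2
  push_cast
  ring

lemma mul_mul_thetaSum_of_inv_sq (hq0 : q ≠ 0) (hqN : q ^ N = 1) (hc : c ^ N = 1)
    (h : T * c = (q ^ 2)⁻¹ • (c * T)) :
    c * T * thetaSum N q c = q • (thetaSum N q c * T) := by
  have hs := (periodic_zpow_sq_smul_pow hq0 hqN hc (-1) 0).sum_range_add 1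
  have h1 : thetaSum N q c = ∑ n ∈ Finset.range N,
      q ^ (-1 * (((n + 1 : ℕ) : ℤ) + 0) ^ 2) • c ^ (n + 1) := by
    rw [hs, thetaSum]
    simp
  conv_rhs => rw [h1]
  rw [thetaSum, Finset.mul_sum, Finset.sum_mul, Finset.smul_sum]
  refine Finset.sum_congr rfl fun n _ ↦ ?_
  rw [mul_smul_comm, mul_assoc, mul_pow_eq_smul h, mul_smul_comm, ← mul_assoc, ← pow_succ',
    smul_mul_assoc, smul_smul, smul_smul, inv_pow, ← pow_mul, ← zpow_natCast, ← _root_.zpow_neg,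
    ← zpow_add₀ hq0, ← zpow_one_add₀ hq0]
  congr 2
  push_cast
  ring

lemma sum_zpow_two_mul_eq_zero (hN : Odd N) (hq : IsPrimitiveRoot q N) {m : ℕ} (hm0 : m ≠ 0)
    (hm : m < N) : ∑ n ∈ Finset.range N, q ^ (-2 * (m : ℤ) * n) = 0 := by
  have h1 : q ^ (-2 * (m : ℤ)) ≠ 1 := by
    rw [Ne, hq.zpow_eq_one_iff_dvd, show -2 * (m : ℤ) = -((2 * m : ℕ) : ℤ) by push_cast; ring,
      dvd_neg, Int.natCast_dvd_natCast, (Nat.coprime_two_right.mpr hN).dvd_mul_left]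
    exact fun h ↦ absurd (Nat.le_of_dvd (Nat.pos_of_ne_zero hm0) h) (by omega)
  have h2 : ∑ n ∈ Finset.range N, q ^ (-2 * (m : ℤ) * n)
      = ∑ n ∈ Finset.range N, (q ^ (-2 * (m : ℤ))) ^ n :=
    Finset.sum_congr rfl fun n _ ↦ by rw [_root_.zpow_mul, zpow_natCast]
  rw [h2, geom_sum_eq h1, ← zpow_natCast, ← _root_.zpow_mul, mul_comm, _root_.zpow_mul,
    zpow_natCast, hq.pow_eq_one, _root_.one_zpow, sub_self, zero_div]

lemma thetaSum_mul_thetaSum_inv (hN : Odd N) (hq : IsPrimitiveRoot q N) (hc : c ^ N = 1) :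
    thetaSum N q c * thetaSum N q⁻¹ c = (N : ℂ) • (1 : A) := by
  have hq0 : q ≠ 0 := hq.ne_zero hN.pos.ne'
  have h1 (n : ℕ) : c ^ n * thetaSum N q⁻¹ c
      = ∑ m ∈ Finset.range N, q ^ (1 * ((m : ℤ) + -n) ^ 2) • c ^ m := by
    rw [← (periodic_zpow_sq_smul_pow hq0 hq.pow_eq_one hc 1 (-n)).sum_range_add n, thetaSum,
      Finset.mul_sum]
    refine Finset.sum_congr rfl fun m _ ↦ ?_
    rw [mul_smul_comm, ← pow_add, add_comm n m, _root_.inv_zpow', neg_neg]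
    congr 2
    push_cast
    ring
  have h2 : thetaSum N q c * thetaSum N q⁻¹ c = ∑ m ∈ Finset.range N,
      (q ^ ((m : ℤ) ^ 2) * ∑ n ∈ Finset.range N, q ^ (-2 * (m : ℤ) * n)) • c ^ m := by
    conv_lhs => rw [thetaSum, Finset.sum_mul]
    simp_rw [smul_mul_assoc, h1, Finset.smul_sum]
    rw [Finset.sum_comm]
    refine Finset.sum_congr rfl fun m _ ↦ ?_
    rw [Finset.mul_sum, Finset.sum_smul]
    refine Finset.sum_congr rfl fun n _ ↦ ?_
    rw [smul_smul, ← zpow_add₀ hq0, ← zpow_add₀ hq0]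
    congr 2
    ring
  rw [h2, Finset.sum_eq_single_of_mem 0 (Finset.mem_range.mpr hN.pos)]
  · simp
  · intro m hm hm0
    rw [sum_zpow_two_mul_eq_zero hN hq hm0 (Finset.mem_range.mp hm), mul_zero, zero_smul]

lemma isUnit_thetaSum (hN : Odd N) (hq : IsPrimitiveRoot q N) (hc : c ^ N = 1) :
    IsUnit (thetaSum N q c) := by
  have hN0 : (N : ℂ) ≠ 0 := Nat.cast_ne_zero.mpr hN.pos.ne'
  have h := thetaSum_mul_thetaSum_inv hN hq hc
  have hcomm : Commute (thetaSum N q c) (thetaSum N q⁻¹ c) :=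
    ((Commute.refl c).thetaSum_right.symm).thetaSum_right
  refine ⟨⟨thetaSum N q c, (N : ℂ)⁻¹ • thetaSum N q⁻¹ c, ?_, ?_⟩, rfl⟩
  · rw [mul_smul_comm, h, inv_smul_smul₀ hN0]
  · rw [smul_mul_assoc, ← hcomm.eq, h, inv_smul_smul₀ hN0]

end ThetaSum

/-- The main factorization theorem: `𝒪(χ) : Ω_{rs} ⊗ φ_{c₀} → ρ_r ⊗ ρ̄_s` is an
isomorphism of `U_q(b₊)`-representations (stated on the generators). -/
theorem stmt_5 (N : ℕ) (hN : 3 ≤ N) (hNodd : Odd N)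
    (q : ℂ) (hq : IsPrimitiveRoot q N)
    (X Z : Matrix (Fin N) (Fin N) ℂ) (hXu : IsUnit X) (hZu : IsUnit Z)
    (hZX : Z * X = q • (X * Z)) (hXN : X ^ N = 1) (hZN : Z ^ N = 1)
    (xr yr μr xs ys μs κ₀ κ₁ c₀ : ℂ)
    (hxr : xr ≠ 0) (hyr : yr ≠ 0) (hμr : μr ≠ 0)
    (hxs : xs ≠ 0) (hys : ys ≠ 0) (hμs : μs ≠ 0)
    (hκ₀ : κ₀ ≠ 0) (hκ₁ : κ₁ ≠ 0)
    (hc₀ : c₀ ^ 2 = q ^ 2 * xr * xs / (yr * ys))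
    (Ωe₀ Ωe₁ Ωt₀ Ωt₁ φt₀ φt₁ ρe₀ ρe₁ ρt₀ ρt₁ ρbe₀ ρbe₁ ρbt₀ ρbt₁ :
      Matrix (Fin N) (Fin N) ℂ)
    (hΩe₀ : Ωe₀ = (κ₀ * xr / (q - q⁻¹)) •
      (X⁻¹ * ((ys / (xr * μr * μs)) • (Z⁻¹) ^ 2 - 1)))
    (hΩe₁ : Ωe₁ = (κ₁ * yr / (q - q⁻¹)) •
      (((xs * μr * μs / yr) • Z ^ 2 - 1) * X))
    (hΩt₀ : Ωt₀ = (c₀ * yr * ys / (q ^ 2 * xr * xs * μr * μs)) • (Z⁻¹) ^ 2)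
    (hΩt₁ : Ωt₁ = Ωt₀⁻¹)
    (hφt₀ : φt₀ = (c₀ / q) • (Z⁻¹) ^ 2)
    (hφt₁ : φt₁ = (q / c₀) • Z ^ 2)
    (hρe₀ : ρe₀ = (-(κ₀ * xr / (q - q⁻¹))) • X⁻¹)
    (hρe₁ : ρe₁ = (-(κ₁ * yr / (q - q⁻¹))) • X)
    (hρt₀ : ρt₀ = (q * μr)⁻¹ • (Z⁻¹) ^ 2)
    (hρt₁ : ρt₁ = (q * μr) • Z ^ 2)
    (hρbe₀ : ρbe₀ = (κ₀ * ys / (μs * (q - q⁻¹))) • X⁻¹)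
    (hρbe₁ : ρbe₁ = (κ₁ * xs * μs / (q - q⁻¹)) • X)
    (hρbt₀ : ρbt₀ = μs⁻¹ • (Z⁻¹) ^ 2)
    (hρbt₁ : ρbt₁ = μs • Z ^ 2)
    (O : Matrix (Fin N × Fin N) (Fin N × Fin N) ℂ)
    (hO : O = ∑ n ∈ Finset.range N, q ^ (-((n : ℤ) ^ 2)) • (X⁻¹ ⊗ₖ X) ^ n) :
    IsUnit O ∧
    O * (Ωe₀ ⊗ₖ (1 : Matrix (Fin N) (Fin N) ℂ))
      = (ρe₀ ⊗ₖ (1 : Matrix (Fin N) (Fin N) ℂ) + ρt₀ ⊗ₖ ρbe₀) * O ∧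
    O * (Ωe₁ ⊗ₖ (1 : Matrix (Fin N) (Fin N) ℂ))
      = (ρe₁ ⊗ₖ (1 : Matrix (Fin N) (Fin N) ℂ) + ρt₁ ⊗ₖ ρbe₁) * O ∧
    O * (Ωt₀ ⊗ₖ φt₀) = (ρt₀ ⊗ₖ ρbt₀) * O ∧
    O * (Ωt₁ ⊗ₖ φt₁) = (ρt₁ ⊗ₖ ρbt₁) * O := by
  have hN0 : N ≠ 0 := hNodd.pos.ne'
  have hq0 : q ≠ 0 := hq.ne_zero hN0
  have hqN := hq.pow_eq_one
  have hXd : IsUnit X.det := (Matrix.isUnit_iff_isUnit_det X).mp hXu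
  have hZd : IsUnit Z.det := (Matrix.isUnit_iff_isUnit_det Z).mp hZu
  have hXX : X * X⁻¹ = 1 := Matrix.mul_nonsing_inv X hXd
  have hXX' : X⁻¹ * X = 1 := Matrix.nonsing_inv_mul X hXd
  have hZZ : Z * Z⁻¹ = 1 := Matrix.mul_nonsing_inv Z hZd
  have hZZ' : Z⁻¹ * Z = 1 := Matrix.nonsing_inv_mul Z hZd
  have hZ2X : Z ^ 2 * X = (q ^ 2) • (X * Z ^ 2) := by
    rw [pow_two Z, mul_assoc, hZX, mul_smul_comm, ← mul_assoc, hZX, smul_mul_assoc, smul_smul,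
      mul_assoc, pow_two q]
  have hZZ2 : Z ^ 2 * Z⁻¹ ^ 2 = 1 := by
    rw [pow_two, pow_two, mul_assoc, ← mul_assoc Z Z⁻¹, hZZ, one_mul, hZZ]
  have hZZ2' : Z⁻¹ ^ 2 * Z ^ 2 = 1 := by
    rw [pow_two, pow_two, mul_assoc, ← mul_assoc Z⁻¹ Z, hZZ', one_mul, hZZ']
  have hq2 : q ^ 2 ≠ 0 := pow_ne_zero 2 hq0
  have hZ2Xi : Z ^ 2 * X⁻¹ = (q ^ 2)⁻¹ • (X⁻¹ * Z ^ 2) := by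
    rw [eq_inv_smul_iff₀ hq2]
    calc (q ^ 2) • (Z ^ 2 * X⁻¹) = X⁻¹ * ((q ^ 2) • (X * Z ^ 2)) * X⁻¹ := by
          rw [mul_smul_comm, ← mul_assoc, hXX', one_mul, smul_mul_assoc]
      _ = X⁻¹ * Z ^ 2 := by
          rw [← hZ2X, mul_assoc, mul_assoc, hXX, mul_one]
  have hZi2Xi : Z⁻¹ ^ 2 * X⁻¹ = (q ^ 2) • (X⁻¹ * Z⁻¹ ^ 2) := by
    rw [← inv_smul_eq_iff₀ hq2]
    calc (q ^ 2)⁻¹ • (Z⁻¹ ^ 2 * X⁻¹) = Z⁻¹ ^ 2 * ((q ^ 2)⁻¹ • (X⁻¹ * Z ^ 2)) * Z⁻¹ ^ 2 := by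
          rw [mul_smul_comm, smul_mul_assoc, mul_assoc, mul_assoc, hZZ2, mul_one]
      _ = X⁻¹ * Z⁻¹ ^ 2 := by
          rw [← hZ2Xi, ← mul_assoc, hZZ2', one_mul]
  set c : Matrix (Fin N × Fin N) (Fin N × Fin N) ℂ := X⁻¹ ⊗ₖ X with hc_def
  have hpow (n : ℕ) : c ^ n = (X⁻¹ ^ n) ⊗ₖ (X ^ n) := by
    induction n with
    | zero => simp
    | succ n ih => rw [pow_succ, ih, hc_def, ← mul_kronecker_mul, ← pow_succ, ← pow_succ]
  have hc : c ^ N = 1 := by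
    rw [hpow, Matrix.inv_pow', hXN, inv_one, one_kronecker_one]
  have hO' : O = thetaSum N q c := hO
  have hXc : Commute (X ⊗ₖ (1 : Matrix (Fin N) (Fin N) ℂ)) c := by
    rw [Commute, SemiconjBy, hc_def, ← mul_kronecker_mul, ← mul_kronecker_mul, hXX, hXX',
      one_mul, mul_one]
  have hXic : Commute (X⁻¹ ⊗ₖ (1 : Matrix (Fin N) (Fin N) ℂ)) c := by
    rw [Commute, SemiconjBy, hc_def, ← mul_kronecker_mul, ← mul_kronecker_mul, one_mul, mul_one]
  have hXic' : Commute ((1 : Matrix (Fin N) (Fin N) ℂ) ⊗ₖ X⁻¹) c := by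
    rw [Commute, SemiconjBy, hc_def, ← mul_kronecker_mul, ← mul_kronecker_mul, hXX, hXX',
      one_mul, mul_one]
  have hZc : Commute ((Z ^ 2) ⊗ₖ (Z ^ 2)) c := by
    rw [Commute, SemiconjBy, hc_def, ← mul_kronecker_mul, ← mul_kronecker_mul, hZ2X, hZ2Xi,
      kronecker_smul, smul_kronecker, smul_smul, mul_inv_cancel₀ hq2, one_smul]
  have hZic : Commute ((Z⁻¹ ^ 2) ⊗ₖ (Z⁻¹ ^ 2)) c := by
    have h1 : (Z⁻¹ ^ 2) ⊗ₖ (Z⁻¹ ^ 2) * (Z ^ 2) ⊗ₖ (Z ^ 2) = 1 := by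
      rw [← mul_kronecker_mul, hZZ2', one_kronecker_one]
    have h2 : (Z ^ 2) ⊗ₖ (Z ^ 2) * (Z⁻¹ ^ 2) ⊗ₖ (Z⁻¹ ^ 2) = 1 := by
      rw [← mul_kronecker_mul, hZZ2, one_kronecker_one]
    exact Commute.units_inv_left (u := ⟨_, _, h2, h1⟩) hZc
  have hT₀ : (Z⁻¹ ^ 2) ⊗ₖ (1 : Matrix (Fin N) (Fin N) ℂ) * c
      = (q ^ 2) • (c * (Z⁻¹ ^ 2) ⊗ₖ (1 : Matrix (Fin N) (Fin N) ℂ)) := by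
    rw [hc_def, ← mul_kronecker_mul, ← mul_kronecker_mul, hZi2Xi, smul_kronecker, one_mul,
      mul_one]
  have hT₁ : (Z ^ 2) ⊗ₖ (1 : Matrix (Fin N) (Fin N) ℂ) * c
      = (q ^ 2)⁻¹ • (c * (Z ^ 2) ⊗ₖ (1 : Matrix (Fin N) (Fin N) ℂ)) := by
    rw [hc_def, ← mul_kronecker_mul, ← mul_kronecker_mul, hZ2Xi, smul_kronecker, one_mul,
      mul_one]
  have key₀ : (Z⁻¹ ^ 2) ⊗ₖ X⁻¹ * O
      = q • (O * (X⁻¹ * Z⁻¹ ^ 2) ⊗ₖ (1 : Matrix (Fin N) (Fin N) ℂ)) := by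
    have h1 : (Z⁻¹ ^ 2) ⊗ₖ X⁻¹ = ((1 : Matrix (Fin N) (Fin N) ℂ) ⊗ₖ X⁻¹)
        * ((Z⁻¹ ^ 2) ⊗ₖ (1 : Matrix (Fin N) (Fin N) ℂ)) := by
      rw [← mul_kronecker_mul, one_mul, mul_one]
    have h2 : (1 : Matrix (Fin N) (Fin N) ℂ) ⊗ₖ X⁻¹ * c
        = X⁻¹ ⊗ₖ (1 : Matrix (Fin N) (Fin N) ℂ) := by
      rw [hc_def, ← mul_kronecker_mul, one_mul, hXX']
    have h3 : (X⁻¹ * Z⁻¹ ^ 2) ⊗ₖ (1 : Matrix (Fin N) (Fin N) ℂ)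
        = X⁻¹ ⊗ₖ (1 : Matrix (Fin N) (Fin N) ℂ)
          * (Z⁻¹ ^ 2) ⊗ₖ (1 : Matrix (Fin N) (Fin N) ℂ) := by
      rw [← mul_kronecker_mul, one_mul]
    rw [h1, h3, hO', mul_assoc, mul_thetaSum_of_sq hq0 hqN hc hT₀, mul_smul_comm, ← mul_assoc,
      ← mul_assoc, hXic'.thetaSum_right.eq, mul_assoc (thetaSum N q c), h2, mul_assoc]
  have key₁ : q • ((Z ^ 2) ⊗ₖ X * O)
      = O * (Z ^ 2 * X) ⊗ₖ (1 : Matrix (Fin N) (Fin N) ℂ) := by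
    have h1 : (Z ^ 2) ⊗ₖ X = (X ⊗ₖ (1 : Matrix (Fin N) (Fin N) ℂ))
        * (c * (Z ^ 2) ⊗ₖ (1 : Matrix (Fin N) (Fin N) ℂ)) := by
      rw [hc_def, ← mul_kronecker_mul, ← mul_kronecker_mul, one_mul, mul_one, ← mul_assoc, hXX,
        one_mul]
    have h3 : (Z ^ 2 * X) ⊗ₖ (1 : Matrix (Fin N) (Fin N) ℂ)
        = (q ^ 2) • (X ⊗ₖ (1 : Matrix (Fin N) (Fin N) ℂ)
          * (Z ^ 2) ⊗ₖ (1 : Matrix (Fin N) (Fin N) ℂ)) := by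
      rw [← mul_kronecker_mul, one_mul, hZ2X, smul_kronecker]
    rw [h1, h3, hO', mul_assoc, mul_mul_thetaSum_of_inv_sq hq0 hqN hc hT₁, mul_smul_comm,
      smul_smul, ← mul_assoc, hXc.thetaSum_right.eq, mul_assoc, mul_smul_comm, pow_two q]
  have comm₀ : X⁻¹ ⊗ₖ (1 : Matrix (Fin N) (Fin N) ℂ) * O
      = O * X⁻¹ ⊗ₖ (1 : Matrix (Fin N) (Fin N) ℂ) := by rw [hO', hXic.thetaSum_right.eq]
  have comm₁ : X ⊗ₖ (1 : Matrix (Fin N) (Fin N) ℂ) * O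
      = O * X ⊗ₖ (1 : Matrix (Fin N) (Fin N) ℂ) := by rw [hO', hXc.thetaSum_right.eq]
  have hZO : O * (Z ^ 2) ⊗ₖ (Z ^ 2) = (Z ^ 2) ⊗ₖ (Z ^ 2) * O := by rw [hO', hZc.thetaSum_right.eq]
  have hZiO : O * (Z⁻¹ ^ 2) ⊗ₖ (Z⁻¹ ^ 2) = (Z⁻¹ ^ 2) ⊗ₖ (Z⁻¹ ^ 2) * O := by
    rw [hO', hZic.thetaSum_right.eq]
  have hc0 : c₀ ≠ 0 := by
    rintro rfl
    rw [zero_pow two_ne_zero] at hc₀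
    exact div_ne_zero (mul_ne_zero (mul_ne_zero hq2 hxr) hxs) (mul_ne_zero hyr hys) hc₀.symm
  have hc₀' : c₀ ^ 2 * (yr * ys) = q ^ 2 * xr * xs := by
    rw [hc₀, div_mul_cancel₀ _ (mul_ne_zero hyr hys)]
  have hcoef : c₀ * yr * ys / (q ^ 2 * xr * xs * μr * μs) * (c₀ / q) = (q * μr)⁻¹ * μs⁻¹ := by
    field_simp
    linear_combination hc₀'
  refine ⟨hO' ▸ isUnit_thetaSum hNodd hq hc, ?_, ?_, ?_, ?_⟩
  · rw [hΩe₀, hρe₀, hρt₀, hρbe₀, mul_sub, mul_smul_comm, mul_one, smul_sub, smul_smul,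
      sub_eq_add_neg, ← neg_smul, add_kronecker, mul_add, add_mul]
    simp only [smul_kronecker, kronecker_smul, mul_smul_comm, smul_mul_assoc, smul_smul, comm₀,
      key₀]
    rw [add_comm]
    congr 2
    field_simp
  · rw [hΩe₁, hρe₁, hρt₁, hρbe₁, sub_mul, smul_mul_assoc, one_mul, smul_sub, smul_smul,
      sub_eq_add_neg, ← neg_smul, add_kronecker, mul_add, add_mul]
    simp only [smul_kronecker, kronecker_smul, mul_smul_comm, smul_mul_assoc, smul_smul, comm₁,
      ← key₁]
    rw [add_comm]
    congr 2
    field_simp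
  · rw [hΩt₀, hφt₀, hρt₀, hρbt₀]
    simp only [smul_kronecker, kronecker_smul, mul_smul_comm, smul_mul_assoc, smul_smul, hZiO]
    congr 1
    rw [mul_comm, hcoef, mul_comm]
  · have hinv : Ωt₁ = (c₀ * yr * ys / (q ^ 2 * xr * xs * μr * μs))⁻¹ • Z ^ 2 := by
      rw [hΩt₁, hΩt₀]
      refine Matrix.inv_eq_right_inv ?_
      rw [smul_mul_smul_comm, hZZ2', mul_inv_cancel₀ (by simp [*]), one_smul]
    rw [hinv, hφt₁, hρt₁, hρbt₁]
    simp only [smul_kronecker, kronecker_smul, mul_smul_comm, smul_mul_assoc, smul_smul, hZO]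
    congr 1
    have h := congrArg (·⁻¹) hcoef
    simp only [mul_inv, inv_inv, inv_div] at h ⊢
    linear_combination h
end

section
/- Let N ≥ 3 be odd, q ∈ ℂ a primitive N-th root of unity, and let X, Z be invertible N×N complex matrices with Z·X = q·X·Z and X^N = Z^N = 1. Let x_r, y_r, μ_r, x_s, y_s, μ_s be nonzero complex numbers and suppose Ŵ : ZMod N → ℂ satisfies (μ_s x_s − μ_r x_r q^{2n})·Ŵ(n) = (μ_s y_r − μ_r y_s q^{2(n−1)})·Ŵ(n−1) for every n ∈ ZMod N. Set χ := X⁻¹ ⊗ X and S := ∑_{n=0}^{N-1} Ŵ(n) χ^n. Then the following two identities hold in the N²×N² matrices: μ_s·S·(−y_r·X⁻¹Z⁻² ⊗ 1 + x_s·Z⁻² ⊗ X⁻¹) = μ_r·(−y_s·X⁻¹Z⁻² ⊗ 1 + x_r·Z⁻² ⊗ X⁻¹)·S, and μ_r·S·(−x_r·Z²X ⊗ 1 + y_s·Z² ⊗ X) = μ_s·(−x_s·Z²X ⊗ 1 + y_r·Z² ⊗ X)·S. -/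
open Matrix Kronecker

theorem pow_zmod_val_succ {R : Type*} [Monoid R] {N : ℕ} [NeZero N] {c : R} (hc : c ^ N = 1)
    (n : ZMod N) : c ^ (n + 1).val = c ^ n.val * c := by
  rw [ZMod.val_add, ZMod.val_one_eq_one_mod, Nat.add_mod_mod, ← pow_eq_pow_mod _ hc, pow_succ]

theorem sum_smul_pow_zmod_val_mul {K R : Type*} [CommRing K] [Ring R] [Algebra K R]
    {N : ℕ} [NeZero N] {c : R} (hc : c ^ N = 1) (f : ZMod N → K) :
    (∑ n, f n • c ^ n.val) * c = ∑ n, f (n - 1) • c ^ n.val := by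
  rw [Finset.sum_mul,
    ← Equiv.sum_comp (Equiv.addRight (1 : ZMod N)) fun n => f (n - 1) • c ^ n.val]
  simp [pow_zmod_val_succ hc]

/-- A first-order recursion for the coefficients `f`, written as an identity between
polynomials in `c`. -/
theorem sum_smul_pow_recursion {K R : Type*} [CommRing K] [Ring R] [Algebra K R]
    {N : ℕ} [NeZero N] {c : R} (hc : c ^ N = 1) (t a b u v : K) (f : ZMod N → K)
    (hf : ∀ n : ZMod N, (a - b * t ^ n.val) * f n = (u - v * t ^ (n - 1).val) * f (n - 1)) :
    a • (∑ n, f n • c ^ n.val) - u • ((∑ n, f n • c ^ n.val) * c)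
      = b • (∑ n : ZMod N, (t ^ n.val * f n) • c ^ n.val)
        - v • ((∑ n : ZMod N, (t ^ n.val * f n) • c ^ n.val) * c) := by
  rw [sum_smul_pow_zmod_val_mul hc, sum_smul_pow_zmod_val_mul hc]
  simp only [Finset.smul_sum, ← Finset.sum_sub_distrib, smul_smul, ← sub_smul]
  refine Finset.sum_congr rfl fun n _ => ?_
  congr 1
  linear_combination hf n

theorem mul_pow_of_mul_eq_smul {K R : Type*} [CommRing K] [Ring R] [Algebra K R]
    {B c : R} {t : K} (h : B * c = t • (c * B)) (n : ℕ) :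
    B * c ^ n = t ^ n • (c ^ n * B) := by
  induction n with
  | zero => simp
  | succ n ih =>
    rw [pow_succ, ← mul_assoc, ih, smul_mul_assoc, mul_assoc, h, mul_smul_comm, smul_smul,
      ← mul_assoc, pow_succ]

theorem pow_mul_of_mul_eq_smul {K R : Type*} [CommRing K] [Ring R] [Algebra K R]
    {A c : R} {t : K} (h : c * A = t • (A * c)) (n : ℕ) :
    c ^ n * A = t ^ n • (A * c ^ n) := by
  induction n with
  | zero => simp
  | succ n ih =>
    rw [pow_succ, mul_assoc, h, mul_smul_comm, ← mul_assoc, ih, smul_mul_assoc, smul_smul,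
      mul_assoc, pow_succ, mul_comm t]

theorem sum_smul_pow_intertwines_left {K R : Type*} [CommRing K] [Ring R] [Algebra K R]
    {N : ℕ} [NeZero N] {B c : R} (hc : c ^ N = 1) {t : K} (h : B * c = t • (c * B))
    (μ ν x y x' y' : K) (f : ZMod N → K)
    (hf : ∀ n : ZMod N,
      (μ * x - ν * x' * t ^ n.val) * f n = (μ * y - ν * y' * t ^ (n - 1).val) * f (n - 1)) :
    μ • ((∑ n, f n • c ^ n.val) * ((-y) • (c * B) + x • B))
      = ν • (((-y') • (c * B) + x' • B) * ∑ n, f n • c ^ n.val) := by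
  have key := congrArg (· * B) (sum_smul_pow_recursion hc t _ _ _ _ f hf)
  have hB : B * (∑ n, f n • c ^ n.val) = (∑ n : ZMod N, (t ^ n.val * f n) • c ^ n.val) * B := by
    simp only [Finset.mul_sum, Finset.sum_mul, mul_smul_comm, smul_mul_assoc,
      mul_pow_of_mul_eq_smul h, smul_smul, mul_comm]
  have hcomm : Commute c (∑ n : ZMod N, (t ^ n.val * f n) • c ^ n.val) :=
    Commute.sum_right _ _ _ fun n _ => ((Commute.refl c).pow_right _).smul_right _
  simp only [add_mul, mul_add, smul_mul_assoc, mul_smul_comm, mul_assoc, hB]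
  rw [← mul_assoc c, hcomm.eq]
  simp only [sub_mul, smul_mul_assoc, mul_assoc] at key
  simp only [mul_assoc, smul_add, smul_smul, smul_neg, neg_smul]
  rw [neg_add_eq_sub, neg_add_eq_sub]
  exact key

theorem sum_smul_pow_intertwines_right {K R : Type*} [CommRing K] [Ring R] [Algebra K R]
    {N : ℕ} [NeZero N] {A c : R} (hc : c ^ N = 1) {t : K} (h : c * A = t • (A * c))
    (μ ν x y x' y' : K) (f : ZMod N → K)
    (hf : ∀ n : ZMod N,
      (μ * x - ν * x' * t ^ n.val) * f n = (μ * y - ν * y' * t ^ (n - 1).val) * f (n - 1)) :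
    ν • ((∑ n, f n • c ^ n.val) * ((-x') • A + y' • (A * c)))
      = μ • (((-x) • A + y • (A * c)) * ∑ n, f n • c ^ n.val) := by
  have key := congrArg (A * ·) (sum_smul_pow_recursion hc t _ _ _ _ f hf)
  have hA : (∑ n, f n • c ^ n.val) * A = A * (∑ n : ZMod N, (t ^ n.val * f n) • c ^ n.val) := by
    simp only [Finset.mul_sum, Finset.sum_mul, mul_smul_comm, smul_mul_assoc,
      pow_mul_of_mul_eq_smul h, smul_smul, mul_comm]
  have hcomm : Commute c (∑ n : ZMod N, f n • c ^ n.val) :=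
    Commute.sum_right _ _ _ fun n _ => ((Commute.refl c).pow_right _).smul_right _
  simp only [mul_add, add_mul, smul_mul_assoc, mul_smul_comm, ← mul_assoc, hA]
  rw [mul_assoc A c, hcomm.eq]
  simp only [mul_sub, mul_smul_comm, ← mul_assoc] at key
  simp only [← mul_assoc, smul_add, smul_smul, smul_neg, neg_smul]
  rw [← neg_inj, neg_add, neg_add, neg_neg, neg_neg, ← sub_eq_add_neg, ← sub_eq_add_neg]
  exact key.symm

theorem inv_mul_inv_of_mul_eq_smul {K R : Type*} [CommRing K] [Ring R] [Algebra K R]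
    {X X' Z Z' : R} {q : K} (hX : X * X' = 1) (hX' : X' * X = 1) (hZ : Z * Z' = 1)
    (hZ' : Z' * Z = 1) (h : Z * X = q • (X * Z)) : Z' * X' = q • (X' * Z') :=
  calc Z' * X' = X' * (Z' * Z) * X * (Z' * X') := by rw [hZ', mul_one, hX', one_mul]
    _ = X' * Z' * (Z * X) * (Z' * X') := by simp only [mul_assoc]
    _ = q • (X' * Z' * (X * (Z * Z') * X')) := by
      rw [h]; simp only [mul_smul_comm, smul_mul_assoc, mul_assoc]
    _ = q • (X' * Z') := by rw [hZ, mul_one, hX, mul_one]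

theorem sq_mul_of_mul_eq_smul {K R : Type*} [CommRing K] [Ring R] [Algebra K R]
    {X Z : R} {q : K} (h : Z * X = q • (X * Z)) : Z ^ 2 * X = q ^ 2 • (X * Z ^ 2) := by
  rw [sq, mul_assoc, h, mul_smul_comm, ← mul_assoc, h, smul_mul_assoc, smul_smul, mul_assoc, sq]

theorem kronecker_pow_eq {m n K : Type*} [Fintype m] [Fintype n] [DecidableEq m] [DecidableEq n]
    [CommRing K] (A : Matrix m m K) (B : Matrix n n K) (k : ℕ) :
    (A ⊗ₖ B) ^ k = (A ^ k) ⊗ₖ (B ^ k) := by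
  induction k with
  | zero => simp
  | succ k ih => simp only [pow_succ, ih, mul_kronecker_mul]

/-- The two intertwining identities of Proposition (STalt)(ii): the operator
`S = ∑ Ŵ_{rs}(n) χⁿ` intertwines `ρ̄_r ⊗ ρ_s → ρ̄_s ⊗ ρ_r` on the coproducts of
the generators `e₀` and `e₁`. -/
theorem stmt_6 (N : ℕ) [NeZero N] (hN : 3 ≤ N) (hNodd : Odd N)
    (q : ℂ) (hq : IsPrimitiveRoot q N)
    (X Z : Matrix (Fin N) (Fin N) ℂ) (hXu : IsUnit X) (hZu : IsUnit Z)
    (hZX : Z * X = q • (X * Z)) (hXN : X ^ N = 1) (hZN : Z ^ N = 1)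
    (xr yr μr xs ys μs : ℂ)
    (hxr : xr ≠ 0) (hyr : yr ≠ 0) (hμr : μr ≠ 0)
    (hxs : xs ≠ 0) (hys : ys ≠ 0) (hμs : μs ≠ 0)
    (What : ZMod N → ℂ)
    (hrec : ∀ n : ZMod N,
      (μs * xs - μr * xr * (q ^ 2) ^ n.val) * What n
        = (μs * yr - μr * ys * (q ^ 2) ^ (n - 1).val) * What (n - 1)) :
    μs • ((∑ n : ZMod N, What n • (X⁻¹ ⊗ₖ X) ^ n.val) *
        ((-yr) • ((X⁻¹ * (Z⁻¹) ^ 2) ⊗ₖ (1 : Matrix (Fin N) (Fin N) ℂ))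
          + xs • (((Z⁻¹) ^ 2) ⊗ₖ X⁻¹)))
      = μr • (((-ys) • ((X⁻¹ * (Z⁻¹) ^ 2) ⊗ₖ (1 : Matrix (Fin N) (Fin N) ℂ))
          + xr • (((Z⁻¹) ^ 2) ⊗ₖ X⁻¹)) *
        (∑ n : ZMod N, What n • (X⁻¹ ⊗ₖ X) ^ n.val)) ∧
    μr • ((∑ n : ZMod N, What n • (X⁻¹ ⊗ₖ X) ^ n.val) *
        ((-xr) • ((Z ^ 2 * X) ⊗ₖ (1 : Matrix (Fin N) (Fin N) ℂ))
          + ys • ((Z ^ 2) ⊗ₖ X)))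
      = μs • (((-xs) • ((Z ^ 2 * X) ⊗ₖ (1 : Matrix (Fin N) (Fin N) ℂ))
          + yr • ((Z ^ 2) ⊗ₖ X)) *
        (∑ n : ZMod N, What n • (X⁻¹ ⊗ₖ X) ^ n.val)) := by
  have hX : X * X⁻¹ = 1 := Matrix.mul_nonsing_inv X ((Matrix.isUnit_iff_isUnit_det X).1 hXu)
  have hX' : X⁻¹ * X = 1 := Matrix.nonsing_inv_mul X ((Matrix.isUnit_iff_isUnit_det X).1 hXu)
  have hZ : Z * Z⁻¹ = 1 := Matrix.mul_nonsing_inv Z ((Matrix.isUnit_iff_isUnit_det Z).1 hZu)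
  have hZ' : Z⁻¹ * Z = 1 := Matrix.nonsing_inv_mul Z ((Matrix.isUnit_iff_isUnit_det Z).1 hZu)
  have hc : (X⁻¹ ⊗ₖ X) ^ N = 1 := by
    rw [kronecker_pow_eq, Matrix.inv_pow', hXN, inv_one, one_kronecker_one]
  have hinv := sq_mul_of_mul_eq_smul (inv_mul_inv_of_mul_eq_smul hX hX' hZ hZ' hZX)
  have hA₀ : (X⁻¹ * (Z⁻¹) ^ 2) ⊗ₖ (1 : Matrix (Fin N) (Fin N) ℂ)
      = (X⁻¹ ⊗ₖ X) * (((Z⁻¹) ^ 2) ⊗ₖ X⁻¹) := by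
    rw [← mul_kronecker_mul, hX]
  have hB₁ : (Z ^ 2) ⊗ₖ X
      = ((Z ^ 2 * X) ⊗ₖ (1 : Matrix (Fin N) (Fin N) ℂ)) * (X⁻¹ ⊗ₖ X) := by
    rw [← mul_kronecker_mul, mul_assoc, hX, mul_one, one_mul]
  rw [hA₀, hB₁]
  constructor
  · refine sum_smul_pow_intertwines_left hc (t := q ^ 2) ?_ _ _ _ _ _ _ What hrec
    rw [← mul_kronecker_mul, ← mul_kronecker_mul, hX, hX', hinv, smul_kronecker]
  · refine sum_smul_pow_intertwines_right hc (t := q ^ 2) ?_ _ _ _ _ _ _ What hrec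
    rw [← hB₁, ← mul_kronecker_mul, mul_one, sq_mul_of_mul_eq_smul hZX, mul_smul_comm,
      ← mul_assoc, hX', one_mul, smul_kronecker]
end

section
/- Let N ≥ 3 be odd, q ∈ ℂ a primitive N-th root of unity, and let X, Z be invertible N×N complex matrices with Z·X = q·X·Z and X^N = Z^N = 1. Let x_s, y_s, μ_s, κ₀, κ₁ be nonzero complex numbers, let z_s ∈ ℂ satisfy z_s² = κ₀κ₁ x_s y_s with z_s ≠ 0, and set c_s := −κ₀ x_s μ_s q²/z_s. For x, y, μ nonzero define the N×N matrices ρ^{x,y,μ}(e₀) := −(κ₀ x/(q−q⁻¹))·X⁻¹, ρ^{x,y,μ}(e₁) := −(κ₁ y/(q−q⁻¹))·X, ρ^{x,y,μ}(t₀) := (qμ)⁻¹·Z⁻², ρ^{x,y,μ}(t₁) := qμ·Z², and write ρ_s := ρ^{x_s,y_s,μ_s}, ρ_{sq} := ρ^{qx_s,qy_s,qμ_s}, ρ_{sq⁻¹} := ρ^{q⁻¹x_s,q⁻¹y_s,q⁻¹μ_s}. Let π(e₀) := [[0,0],[z_s,0]], π(e₁) := [[0,z_s],[0,0]], π(t₀)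 := diag(q⁻¹,q), π(t₁) := diag(q,q⁻¹) (2×2 matrices). Define ι : ℂ^N → ℂ^N ⊗ ℂ² by ι(v) := (c_s Z v) ⊗ u₀ + (X Z⁻¹ v) ⊗ u₁ and τ : ℂ^N ⊗ ℂ² → ℂ^N by τ(w ⊗ u₀) := −(q/c_s)·X Z⁻¹ w, τ(w ⊗ u₁) := Z w, where u₀, u₁ is the standard basis of ℂ². Then: (a) for i = 0, 1, (ρ_s(e_i) ⊗ 1₂ + ρ_s(t_i) ⊗ π(e_i))∘ι = ι∘ρ_{sq}(e_i) and (ρ_s(t_i) ⊗ π(t_i))∘ι = ι∘ρ_{sq}(t_i); (b) for i = 0, 1, τ∘(ρ_s(e_i) ⊗ 1₂ + ρ_s(t_i) ⊗ π(e_i)) = ρ_{sq⁻¹}(e_i)∘τ and τ∘(ρ_s(t_i) ⊗ π(t_i)) = ρ_{sq⁻¹}(t_i)∘τ; (c) ι is injective, τ is surjective, and the kernel of τ equals the range of ι. -/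
open Matrix Kronecker

namespace TwoBlock

variable {n : Type*}

/-- The matrix of `v ↦ A v ⊗ u₀ + B v ⊗ u₁`. -/
def col (A B : Matrix n n ℂ) : Matrix (n × Fin 2) n ℂ :=
  Matrix.of fun p j => if p.2 = 0 then A p.1 j else B p.1 j

/-- The matrix of `w ⊗ u₀ ↦ A w`, `w ⊗ u₁ ↦ B w`. -/
def row (A B : Matrix n n ℂ) : Matrix n (n × Fin 2) ℂ :=
  Matrix.of fun i p => if p.2 = 0 then A i p.1 else B i p.1

lemma col_add (A B C D : Matrix n n ℂ) : col A B + col C D = col (A + C) (B + D) := by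
  ext ⟨i, k⟩ j
  fin_cases k <;> simp [col]

lemma row_add (A B C D : Matrix n n ℂ) : row A B + row C D = row (A + C) (B + D) := by
  ext i ⟨j, k⟩
  fin_cases k <;> simp [row]

variable [Fintype n]

lemma col_mul (A B M : Matrix n n ℂ) : col A B * M = col (A * M) (B * M) := by
  ext ⟨i, k⟩ j
  fin_cases k <;> simp [col, Matrix.mul_apply]

lemma mul_row (A B M : Matrix n n ℂ) : M * row A B = row (M * A) (M * B) := by
  ext i ⟨j, k⟩
  fin_cases k <;> simp [row, Matrix.mul_apply]

lemma row_mul_col (A B C D : Matrix n n ℂ) : row A B * col C D = A * C + B * D := by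
  ext i j
  simp [row, col, Matrix.mul_apply, Fintype.sum_prod_type, Finset.sum_add_distrib]

lemma kronecker_mul_col (M A B : Matrix n n ℂ) (P : Matrix (Fin 2) (Fin 2) ℂ) :
    (M ⊗ₖ P) * col A B = col (P 0 0 • (M * A) + P 0 1 • (M * B))
      (P 1 0 • (M * A) + P 1 1 • (M * B)) := by
  ext ⟨i, k⟩ j
  fin_cases k <;>
    simp [col, Matrix.mul_apply, Fintype.sum_prod_type, Finset.sum_add_distrib,
      Finset.mul_sum, mul_assoc, mul_left_comm]

lemma row_mul_kronecker (M A B : Matrix n n ℂ) (P : Matrix (Fin 2) (Fin 2) ℂ) :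
    row A B * (M ⊗ₖ P) = row (P 0 0 • (A * M) + P 1 0 • (B * M))
      (P 0 1 • (A * M) + P 1 1 • (B * M)) := by
  ext i ⟨j, k⟩
  fin_cases k <;>
    simp [row, Matrix.mul_apply, Fintype.sum_prod_type, Finset.sum_add_distrib,
      Finset.mul_sum] <;>
    congr 1 <;> exact Finset.sum_congr rfl fun _ _ => by ring

lemma col_mulVec (A B : Matrix n n ℂ) (v : n → ℂ) (p : n × Fin 2) :
    (col A B *ᵥ v) p = if p.2 = 0 then (A *ᵥ v) p.1 else (B *ᵥ v) p.1 := by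
  obtain ⟨i, k⟩ := p
  fin_cases k <;> simp [col, Matrix.mulVec, dotProduct]

lemma row_mulVec (A B : Matrix n n ℂ) (w : n × Fin 2 → ℂ) :
    row A B *ᵥ w = A *ᵥ (fun i => w (i, 0)) + B *ᵥ (fun i => w (i, 1)) := by
  ext i
  simp [row, Matrix.mulVec, dotProduct, Fintype.sum_prod_type, Finset.sum_add_distrib]

variable [DecidableEq n]

lemma injective_col {A B A' : Matrix n n ℂ} (h : A' * A = 1) :
    Function.Injective (col A B).mulVecLin := by
  intro v w hvw
  have hA : A *ᵥ v = A *ᵥ w := by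
    ext i
    simpa [col_mulVec] using congrFun hvw (i, 0)
  simpa [Matrix.mulVec_mulVec, h] using congrArg (A' *ᵥ ·) hA

lemma surjective_row {A B B' : Matrix n n ℂ} (h : B * B' = 1) :
    Function.Surjective (row A B).mulVecLin := by
  intro v
  refine ⟨col 0 B' *ᵥ v, ?_⟩
  rw [Matrix.mulVecLin_apply, Matrix.mulVec_mulVec, row_mul_col]
  simp [h]

lemma ker_row_eq_range_col {A B C D C' D' : Matrix n n ℂ} (hC : C * C' = 1)
    (hD : D' * D = 1) (h : A * C + D * B = 0) :
    LinearMap.ker (row A D).mulVecLin = LinearMap.range (col C B).mulVecLin := by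
  apply le_antisymm
  · intro w hw
    rw [LinearMap.mem_ker, Matrix.mulVecLin_apply, row_mulVec] at hw
    have hA : A = -(D * B * C') := by
      rw [← neg_mul, ← eq_neg_of_add_eq_zero_left h, mul_assoc, hC, mul_one]
    have hw1 : (fun i => w (i, 1)) = (B * C') *ᵥ (fun i => w (i, 0)) := by
      have := congrArg (D' *ᵥ ·) hw
      simp only [hA, Matrix.mulVec_add, Matrix.mulVec_mulVec, Matrix.mulVec_zero,
        Matrix.neg_mulVec, Matrix.mulVec_neg, hD, Matrix.one_mulVec] at this
      rw [mul_assoc, ← mul_assoc D', hD, one_mul, neg_add_eq_zero] at this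
      exact this.symm
    refine ⟨C' *ᵥ (fun i => w (i, 0)), ?_⟩
    ext ⟨i, k⟩
    fin_cases k
    · simp [col_mulVec, Matrix.mulVec_mulVec, hC]
    · simpa [col_mulVec, Matrix.mulVec_mulVec] using (congrFun hw1 i).symm
  · rintro _ ⟨v, rfl⟩
    rw [LinearMap.mem_ker, Matrix.mulVecLin_apply, Matrix.mulVecLin_apply, Matrix.mulVec_mulVec,
      row_mul_col, h, Matrix.zero_mulVec]

end TwoBlock

open TwoBlock

set_option maxHeartbeats 1000000 in
/-- Short exact sequence `0 → ρ_{sq} → ρ_s ⊗ π_{z_s} → ρ_{sq⁻¹} → 0` of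
`U_q(b₊)`-representations (Theorem SESs (i)). -/
theorem stmt_7 (N : ℕ) (hN : 3 ≤ N) (hNodd : Odd N)
    (q : ℂ) (hq : IsPrimitiveRoot q N)
    (X Z : Matrix (Fin N) (Fin N) ℂ) (hXu : IsUnit X) (hZu : IsUnit Z)
    (hZX : Z * X = q • (X * Z)) (hXN : X ^ N = 1) (hZN : Z ^ N = 1)
    (xs ys μs κ₀ κ₁ : ℂ)
    (hxs : xs ≠ 0) (hys : ys ≠ 0) (hμs : μs ≠ 0) (hκ₀ : κ₀ ≠ 0) (hκ₁ : κ₁ ≠ 0)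
    (zs : ℂ) (hzs : zs ^ 2 = κ₀ * κ₁ * xs * ys) (hzs0 : zs ≠ 0)
    (cs : ℂ) (hcs : cs = -(κ₀ * xs * μs * q ^ 2 / zs))
    (ρe₀ ρe₁ ρt₀ ρt₁ : ℂ → ℂ → ℂ → Matrix (Fin N) (Fin N) ℂ)
    (hρe₀ : ∀ x y μ, ρe₀ x y μ = (-(κ₀ * x / (q - q⁻¹))) • X⁻¹)
    (hρe₁ : ∀ x y μ, ρe₁ x y μ = (-(κ₁ * y / (q - q⁻¹))) • X)
    (hρt₀ : ∀ x y μ, ρt₀ x y μ = (q * μ)⁻¹ • (Z⁻¹) ^ 2)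
    (hρt₁ : ∀ x y μ, ρt₁ x y μ = (q * μ) • Z ^ 2)
    (πe₀ πe₁ πt₀ πt₁ : Matrix (Fin 2) (Fin 2) ℂ)
    (hπe₀ : πe₀ = !![0, 0; zs, 0]) (hπe₁ : πe₁ = !![0, zs; 0, 0])
    (hπt₀ : πt₀ = !![q⁻¹, 0; 0, q]) (hπt₁ : πt₁ = !![q, 0; 0, q⁻¹])
    (ι : Matrix (Fin N × Fin 2) (Fin N) ℂ)
    (hι : ι = Matrix.of fun p j =>
      if p.2 = 0 then (cs • Z) p.1 j else (X * Z⁻¹) p.1 j)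
    (τ : Matrix (Fin N) (Fin N × Fin 2) ℂ)
    (hτ : τ = Matrix.of fun i p =>
      if p.2 = 0 then ((-(q / cs)) • (X * Z⁻¹)) i p.1 else Z i p.1) :
    -- (a) ι intertwines ρ_{sq} with ρ_s ⊗ π_{z_s}
    ((ρe₀ xs ys μs ⊗ₖ (1 : Matrix (Fin 2) (Fin 2) ℂ) + ρt₀ xs ys μs ⊗ₖ πe₀) * ι
        = ι * ρe₀ (q * xs) (q * ys) (q * μs) ∧
      (ρe₁ xs ys μs ⊗ₖ (1 : Matrix (Fin 2) (Fin 2) ℂ) + ρt₁ xs ys μs ⊗ₖ πe₁) * ι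
        = ι * ρe₁ (q * xs) (q * ys) (q * μs) ∧
      (ρt₀ xs ys μs ⊗ₖ πt₀) * ι = ι * ρt₀ (q * xs) (q * ys) (q * μs) ∧
      (ρt₁ xs ys μs ⊗ₖ πt₁) * ι = ι * ρt₁ (q * xs) (q * ys) (q * μs)) ∧
    -- (b) τ intertwines ρ_s ⊗ π_{z_s} with ρ_{sq⁻¹}
    (τ * (ρe₀ xs ys μs ⊗ₖ (1 : Matrix (Fin 2) (Fin 2) ℂ) + ρt₀ xs ys μs ⊗ₖ πe₀)
        = ρe₀ (q⁻¹ * xs) (q⁻¹ * ys) (q⁻¹ * μs) * τ ∧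
      τ * (ρe₁ xs ys μs ⊗ₖ (1 : Matrix (Fin 2) (Fin 2) ℂ) + ρt₁ xs ys μs ⊗ₖ πe₁)
        = ρe₁ (q⁻¹ * xs) (q⁻¹ * ys) (q⁻¹ * μs) * τ ∧
      τ * (ρt₀ xs ys μs ⊗ₖ πt₀) = ρt₀ (q⁻¹ * xs) (q⁻¹ * ys) (q⁻¹ * μs) * τ ∧
      τ * (ρt₁ xs ys μs ⊗ₖ πt₁) = ρt₁ (q⁻¹ * xs) (q⁻¹ * ys) (q⁻¹ * μs) * τ) ∧
    -- (c) exactness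
    (Function.Injective ι.mulVecLin ∧ Function.Surjective τ.mulVecLin ∧
      LinearMap.ker τ.mulVecLin = LinearMap.range ι.mulVecLin) := by
  have hq0 : q ≠ 0 := hq.ne_zero (by omega)
  have hq2 : q ^ 2 - 1 ≠ 0 := fun h =>
    hq.pow_ne_one_of_pos_of_lt two_ne_zero (by omega) (sub_eq_zero.mp h)
  have hcs0 : cs ≠ 0 := by
    rw [hcs]
    exact neg_ne_zero.mpr (by positivity)
  have hXd := (Matrix.isUnit_iff_isUnit_det X).mp hXu
  have hZd := (Matrix.isUnit_iff_isUnit_det Z).mp hZu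
  have hXY : X * X⁻¹ = 1 := Matrix.mul_nonsing_inv X hXd
  have hYX : X⁻¹ * X = 1 := Matrix.nonsing_inv_mul X hXd
  have hZW : Z * Z⁻¹ = 1 := Matrix.mul_nonsing_inv Z hZd
  have hWZ : Z⁻¹ * Z = 1 := Matrix.nonsing_inv_mul Z hZd
  have hκ : κ₁ = zs ^ 2 / (κ₀ * xs * ys) := by
    rw [hzs]; field_simp
  have hDq : q - q⁻¹ = (q ^ 2 - 1) / q := by field_simp
  generalize X⁻¹ = Y at *
  generalize Z⁻¹ = W at *
  have hZY : Z * Y = q⁻¹ • (Y * Z) := by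
    rw [eq_inv_smul_iff₀ hq0]
    calc q • (Z * Y) = Y * (q • (X * Z)) * Y := by
          simp only [Matrix.mul_smul, Matrix.smul_mul, ← mul_assoc, hYX, one_mul]
      _ = Y * Z := by rw [← hZX, mul_assoc, mul_assoc, hXY, mul_one]
  have hWX : W * X = q⁻¹ • (X * W) := by
    rw [eq_inv_smul_iff₀ hq0]
    calc q • (W * X) = W * (q • (X * Z)) * W := by
          simp only [Matrix.mul_smul, Matrix.smul_mul, mul_assoc, hZW, mul_one]
      _ = X * W := by rw [← hZX, ← mul_assoc, hWZ, one_mul]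
  have hWY : W * Y = q • (Y * W) := by
    have h : Y * Z = q • (Z * Y) := by rw [hZY, smul_inv_smul₀ hq0]
    calc W * Y = W * (Y * Z) * W := by simp only [mul_assoc, hZW, mul_one]
      _ = q • (Y * W) := by
          rw [h, Matrix.mul_smul, Matrix.smul_mul, ← mul_assoc, hWZ, one_mul]
  have extend {A B C : Matrix (Fin N) (Fin N) ℂ} (h : A * B = C) (M : Matrix (Fin N) (Fin N) ℂ) :
      A * (B * M) = C * M := by rw [← mul_assoc, h]
  have hι' : ι = col (cs • Z) (X * W) := hι
  have hτ' : τ = row (-(q / cs) • (X * W)) Z := hτ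
  clear hι hτ
  subst hι' hτ' hπe₀ hπe₁ hπt₀ hπt₁
  simp only [hρe₀, hρe₁, hρt₀, hρt₁, Matrix.add_mul, Matrix.mul_add, kronecker_mul_col,
    row_mul_kronecker, col_add, row_add, col_mul, mul_row]
  refine ⟨⟨?_, ?_, ?_, ?_⟩, ⟨?_, ?_, ?_, ?_⟩, injective_col (A' := cs⁻¹ • W) ?_,
    surjective_row hZW, ker_row_eq_range_col (C' := cs⁻¹ • W) ?_ hWZ ?_⟩
  case refine_9 => simp [smul_smul, hWZ, hcs0]
  case refine_10 => simp [smul_smul, hZW, hcs0]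
  case refine_11 => simp [smul_smul, mul_assoc, hWZ, extend hZX, hZW, mul_div_cancel₀, hcs0]
  all_goals
    congr 1 <;>
    simp [pow_two, mul_assoc, hZX, hZY, hWX, hWY, hZW, hWZ, extend hZX, extend hWX, extend hXY,
      extend hYX, extend hZW, extend hWZ] <;>
    match_scalars <;>
    try simp only [hcs, hκ, hDq]
  all_goals
    field_simp
    try ring
end

section
/- Let N ≥ 3 be odd, q ∈ ℂ a primitive N-th root of unity, and let X, Z be invertible N×N complex matrices with Z·X = q·X·Z and X^N = Z^N = 1. Let x_s, y_s, μ_s, κ₀, κ₁ be nonzero complex numbers, let z_s ∈ ℂ satisfy z_s² = κ₀κ₁ x_s y_s with z_s ≠ 0, and set c̄_s := κ₀ y_s q/z_s. For x, y, μ nonzero define ρ̄^{x,y,μ}(e₀) := (κ₀ y/(μ(q−q⁻¹)))·X⁻¹, ρ̄^{x,y,μ}(e₁) := (κ₁ x μ/(q−q⁻¹))·X, ρ̄^{x,y,μ}(t₀) := μ⁻¹·Z⁻², ρ̄^{x,y,μ}(t₁) := μ·Z², and write ρ̄_s := ρ̄^{x_s,y_s,μ_s}, ρ̄_{sq} :=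 ρ̄^{qx_s,qy_s,qμ_s}, ρ̄_{sq⁻¹} := ρ̄^{q⁻¹x_s,q⁻¹y_s,q⁻¹μ_s}. Let π(e₀) := [[0,0],[z_s,0]], π(e₁) := [[0,z_s],[0,0]], π(t₀) := diag(q⁻¹,q), π(t₁) := diag(q,q⁻¹). Define ῑ : ℂ^N → ℂ^N ⊗ ℂ² by ῑ(v) := (c̄_s v) ⊗ u₀ + (X Z⁻² v) ⊗ u₁ and τ̄ : ℂ^N ⊗ ℂ² → ℂ^N by τ̄(w ⊗ u₀) := −(1/c̄_s)·X Z⁻² w, τ̄(w ⊗ u₁) := w. Then: (a) for i = 0, 1, (ρ̄_s(e_i) ⊗ 1₂ + ρ̄_s(t_i) ⊗ π(e_i))∘ῑ = ῑ∘ρ̄_{sq}(e_i) and (ρ̄_s(t_i) ⊗ π(t_i))∘ῑ = ῑ∘ρ̄_{sq}(t_i); (b) for i = 0, 1, τ̄∘(ρ̄_s(e_i) ⊗ 1₂ + ρ̄_s(t_i) ⊗ π(e_i)) = ρ̄_{sq⁻¹}(e_i)∘τ̄ and τ̄∘(ρ̄_s(t_i) ⊗ π(t_i)) = ρ̄_{sq⁻¹}(t_i)∘τ̄;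 (c) ῑ is injective, τ̄ is surjective, and the kernel of τ̄ equals the range of ῑ. -/
open Matrix Kronecker

section BlockMatrices

variable {n : Type*} {R : Type*} [CommRing R]

/-- The block column with blocks `A` and `B`, the rows being indexed as in a Kronecker product. -/
def kronCol (A B : Matrix n n R) : Matrix (n × Fin 2) n R :=
  Matrix.of fun p j => if p.2 = 0 then A p.1 j else B p.1 j

/-- The block row with blocks `A` and `B`, the columns being indexed as in a Kronecker product. -/
def kronRow (A B : Matrix n n R) : Matrix n (n × Fin 2) R :=
  Matrix.of fun i p => if p.2 = 0 then A i p.1 else B i p.1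

theorem kronCol_add (A B A' B' : Matrix n n R) :
    kronCol A B + kronCol A' B' = kronCol (A + A') (B + B') := by
  ext ⟨i, a⟩ j
  fin_cases a <;> simp [kronCol]

theorem kronRow_add (A B A' B' : Matrix n n R) :
    kronRow A B + kronRow A' B' = kronRow (A + A') (B + B') := by
  ext i ⟨j, a⟩
  fin_cases a <;> simp [kronRow]

variable [Fintype n]

theorem kronecker_mul_kronCol (M A B : Matrix n n R) (P : Matrix (Fin 2) (Fin 2) R) :
    (M ⊗ₖ P) * kronCol A B =
      kronCol (P 0 0 • (M * A) + P 0 1 • (M * B)) (P 1 0 • (M * A) + P 1 1 • (M * B)) := by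
  ext ⟨i, a⟩ j
  fin_cases a <;>
  · simp only [kronCol, Matrix.mul_apply, Fintype.sum_prod_type, Fin.sum_univ_two,
      Matrix.kroneckerMap_apply, Matrix.of_apply, Matrix.add_apply, Matrix.smul_apply,
      smul_eq_mul, Finset.mul_sum, Finset.sum_add_distrib]
    simp [mul_assoc, mul_left_comm]

theorem kronRow_mul_kronecker (M A B : Matrix n n R) (P : Matrix (Fin 2) (Fin 2) R) :
    kronRow A B * (M ⊗ₖ P) =
      kronRow (P 0 0 • (A * M) + P 1 0 • (B * M)) (P 0 1 • (A * M) + P 1 1 • (B * M)) := by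
  ext i ⟨j, a⟩
  fin_cases a <;>
  · simp only [kronRow, Matrix.mul_apply, Fintype.sum_prod_type, Fin.sum_univ_two,
      Matrix.kroneckerMap_apply, Matrix.of_apply, Matrix.add_apply, Matrix.smul_apply,
      smul_eq_mul, Finset.mul_sum, Finset.sum_add_distrib]
    congr 1 <;> exact Finset.sum_congr rfl fun _ _ => by simp; ring

theorem kronCol_mul (M A B : Matrix n n R) :
    kronCol A B * M = kronCol (A * M) (B * M) := by
  ext ⟨i, a⟩ j
  fin_cases a <;> simp [kronCol, Matrix.mul_apply]

theorem mul_kronRow (M A B : Matrix n n R) :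
    M * kronRow A B = kronRow (M * A) (M * B) := by
  ext i ⟨j, a⟩
  fin_cases a <;> simp [kronRow, Matrix.mul_apply]

theorem kronCol_mulVec (A B : Matrix n n R) (v : n → R) :
    kronCol A B *ᵥ v = fun p => if p.2 = 0 then (A *ᵥ v) p.1 else (B *ᵥ v) p.1 := by
  ext ⟨i, a⟩
  fin_cases a <;> simp [kronCol, Matrix.mulVec, dotProduct]

theorem kronRow_mulVec (A B : Matrix n n R) (v : n × Fin 2 → R) :
    kronRow A B *ᵥ v = A *ᵥ (fun i => v (i, 0)) + B *ᵥ (fun i => v (i, 1)) := by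
  ext i
  simp [kronRow, Matrix.mulVec, dotProduct, Fintype.sum_prod_type, Finset.sum_add_distrib]

end BlockMatrices

section Exactness

variable {n K : Type*} [Fintype n] [DecidableEq n] [Field K] {c : K} (T : Matrix n n K)

theorem injective_mulVecLin_kronCol_smul_one (hc : c ≠ 0) :
    Function.Injective (kronCol (c • 1) T).mulVecLin := by
  intro v w h
  ext i
  simpa [kronCol_mulVec, Matrix.smul_mulVec, hc] using congrFun h (i, 0)

theorem surjective_mulVecLin_kronRow_one : Function.Surjective (kronRow T 1).mulVecLin := by
  intro w
  refine ⟨fun p => if p.2 = 0 then 0 else w p.1, ?_⟩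
  have h0 : (fun _ : n => (0 : K)) = 0 := rfl
  simp [kronRow_mulVec, h0]

theorem ker_mulVecLin_kronRow_eq_range_kronCol (hc : c ≠ 0) :
    LinearMap.ker (kronRow (-(1 / c) • T) 1).mulVecLin =
      LinearMap.range (kronCol (c • 1) T).mulVecLin := by
  ext v
  simp only [LinearMap.mem_ker, LinearMap.mem_range, Matrix.mulVecLin_apply, kronRow_mulVec,
    kronCol_mulVec, Matrix.smul_mulVec, Matrix.one_mulVec]
  constructor
  · intro h
    refine ⟨c⁻¹ • fun i => v (i, 0), ?_⟩
    ext ⟨i, a⟩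
    have hi := congrFun h i
    fin_cases a
    · simp [hc]
    · simp [Matrix.mulVec_smul] at hi ⊢
      linear_combination -hi
  · rintro ⟨w, rfl⟩
    have hw : (fun i => c * w i) = c • w := rfl
    ext i
    simp [hw, Matrix.mulVec_smul, hc]

end Exactness


/-- Short exact sequence `0 → ρ̄_{sq} → ρ̄_s ⊗ π_{z_s} → ρ̄_{sq⁻¹} → 0` of
`U_q(b₊)`-representations (Theorem SESs (ii)). -/
theorem stmt_8 (N : ℕ) (hN : 3 ≤ N) (hNodd : Odd N)
    (q : ℂ) (hq : IsPrimitiveRoot q N)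
    (X Z : Matrix (Fin N) (Fin N) ℂ) (hXu : IsUnit X) (hZu : IsUnit Z)
    (hZX : Z * X = q • (X * Z)) (hXN : X ^ N = 1) (hZN : Z ^ N = 1)
    (xs ys μs κ₀ κ₁ : ℂ)
    (hxs : xs ≠ 0) (hys : ys ≠ 0) (hμs : μs ≠ 0) (hκ₀ : κ₀ ≠ 0) (hκ₁ : κ₁ ≠ 0)
    (zs : ℂ) (hzs : zs ^ 2 = κ₀ * κ₁ * xs * ys) (hzs0 : zs ≠ 0)
    (cbs : ℂ) (hcbs : cbs = κ₀ * ys * q / zs)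
    (ρbe₀ ρbe₁ ρbt₀ ρbt₁ : ℂ → ℂ → ℂ → Matrix (Fin N) (Fin N) ℂ)
    (hρbe₀ : ∀ x y μ, ρbe₀ x y μ = (κ₀ * y / (μ * (q - q⁻¹))) • X⁻¹)
    (hρbe₁ : ∀ x y μ, ρbe₁ x y μ = (κ₁ * x * μ / (q - q⁻¹)) • X)
    (hρbt₀ : ∀ x y μ, ρbt₀ x y μ = μ⁻¹ • (Z⁻¹) ^ 2)
    (hρbt₁ : ∀ x y μ, ρbt₁ x y μ = μ • Z ^ 2)
    (πe₀ πe₁ πt₀ πt₁ : Matrix (Fin 2) (Fin 2) ℂ)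
    (hπe₀ : πe₀ = !![0, 0; zs, 0]) (hπe₁ : πe₁ = !![0, zs; 0, 0])
    (hπt₀ : πt₀ = !![q⁻¹, 0; 0, q]) (hπt₁ : πt₁ = !![q, 0; 0, q⁻¹])
    (ιb : Matrix (Fin N × Fin 2) (Fin N) ℂ)
    (hιb : ιb = Matrix.of fun p j =>
      if p.2 = 0 then (cbs • (1 : Matrix (Fin N) (Fin N) ℂ)) p.1 j
      else (X * (Z⁻¹) ^ 2) p.1 j)
    (τb : Matrix (Fin N) (Fin N × Fin 2) ℂ)
    (hτb : τb = Matrix.of fun i p =>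
      if p.2 = 0 then ((-(1 / cbs)) • (X * (Z⁻¹) ^ 2)) i p.1
      else (1 : Matrix (Fin N) (Fin N) ℂ) i p.1) :
    -- (a) ῑ intertwines ρ̄_{sq} with ρ̄_s ⊗ π_{z_s}
    ((ρbe₀ xs ys μs ⊗ₖ (1 : Matrix (Fin 2) (Fin 2) ℂ) + ρbt₀ xs ys μs ⊗ₖ πe₀) * ιb
        = ιb * ρbe₀ (q * xs) (q * ys) (q * μs) ∧
      (ρbe₁ xs ys μs ⊗ₖ (1 : Matrix (Fin 2) (Fin 2) ℂ) + ρbt₁ xs ys μs ⊗ₖ πe₁) * ιb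
        = ιb * ρbe₁ (q * xs) (q * ys) (q * μs) ∧
      (ρbt₀ xs ys μs ⊗ₖ πt₀) * ιb = ιb * ρbt₀ (q * xs) (q * ys) (q * μs) ∧
      (ρbt₁ xs ys μs ⊗ₖ πt₁) * ιb = ιb * ρbt₁ (q * xs) (q * ys) (q * μs)) ∧
    -- (b) τ̄ intertwines ρ̄_s ⊗ π_{z_s} with ρ̄_{sq⁻¹}
    (τb * (ρbe₀ xs ys μs ⊗ₖ (1 : Matrix (Fin 2) (Fin 2) ℂ) + ρbt₀ xs ys μs ⊗ₖ πe₀)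
        = ρbe₀ (q⁻¹ * xs) (q⁻¹ * ys) (q⁻¹ * μs) * τb ∧
      τb * (ρbe₁ xs ys μs ⊗ₖ (1 : Matrix (Fin 2) (Fin 2) ℂ) + ρbt₁ xs ys μs ⊗ₖ πe₁)
        = ρbe₁ (q⁻¹ * xs) (q⁻¹ * ys) (q⁻¹ * μs) * τb ∧
      τb * (ρbt₀ xs ys μs ⊗ₖ πt₀) = ρbt₀ (q⁻¹ * xs) (q⁻¹ * ys) (q⁻¹ * μs) * τb ∧
      τb * (ρbt₁ xs ys μs ⊗ₖ πt₁) = ρbt₁ (q⁻¹ * xs) (q⁻¹ * ys) (q⁻¹ * μs) * τb) ∧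
    -- (c) exactness
    (Function.Injective ιb.mulVecLin ∧ Function.Surjective τb.mulVecLin ∧
      LinearMap.ker τb.mulVecLin = LinearMap.range ιb.mulVecLin) := by
  have hq0 : q ≠ 0 := hq.ne_zero (by omega)
  have hq2 : q ^ 2 ≠ 1 := hq.pow_ne_one_of_pos_of_lt (by omega) (by omega)
  have hd : q - q⁻¹ ≠ 0 := by
    intro h
    apply hq2
    field_simp at h
    linear_combination h
  have hc0 : cbs ≠ 0 := by
    rw [hcbs]
    positivity
  have hXdet : IsUnit X.det := (Matrix.isUnit_iff_isUnit_det X).1 hXu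
  have hZdet : IsUnit Z.det := (Matrix.isUnit_iff_isUnit_det Z).1 hZu
  set W := X⁻¹ with hW
  set Y := Z⁻¹ with hY
  have hXW : X * W = 1 := Matrix.mul_nonsing_inv X hXdet
  have hWX : W * X = 1 := Matrix.nonsing_inv_mul X hXdet
  have hZY : Z * Y = 1 := Matrix.mul_nonsing_inv Z hZdet
  have hYZ : Y * Z = 1 := Matrix.nonsing_inv_mul Z hZdet
  have hXY : X * Y = q • (Y * X) := by
    calc X * Y = Y * (Z * X) * Y := by rw [← mul_assoc, hYZ, one_mul]
      _ = q • (Y * X) := by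
        rw [hZX, mul_smul_comm, smul_mul_assoc, mul_assoc, mul_assoc, hZY, mul_one]
  have hXY2 : X * Y ^ 2 = q ^ 2 • (Y ^ 2 * X) := by
    rw [pow_two, ← mul_assoc, hXY, smul_mul_assoc, mul_assoc, hXY, mul_smul_comm, smul_smul,
      ← mul_assoc, pow_two]
  have hZY2 : Z ^ 2 * Y ^ 2 = 1 := by
    rw [pow_two, pow_two, mul_assoc, ← mul_assoc Z Y, hZY, one_mul, hZY]
  have hYZ2 : Y ^ 2 * Z ^ 2 = 1 := by
    rw [pow_two, pow_two, mul_assoc, ← mul_assoc Y Z, hYZ, one_mul, hYZ]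
  obtain ⟨T, hT⟩ : ∃ T, T = X * Y ^ 2 := ⟨_, rfl⟩
  have hWT : W * T = Y ^ 2 := by rw [hT, ← mul_assoc, hWX, one_mul]
  have hTW : T * W = q ^ 2 • Y ^ 2 := by
    rw [hT, hXY2, smul_mul_assoc, mul_assoc, hXW, mul_one]
  have hZT : Z ^ 2 * T = q ^ 2 • X := by
    rw [hT, hXY2, mul_smul_comm, ← mul_assoc, hZY2, one_mul]
  have hTZ : T * Z ^ 2 = X := by rw [hT, mul_assoc, hYZ2, mul_one]
  have hXT : X * T = q ^ 2 • (T * X) := by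
    rw [hT, mul_assoc X, ← mul_smul_comm, ← hXY2]
  have hTY : T * Y ^ 2 = q ^ 2 • (Y ^ 2 * T) := by
    rw [hT, ← mul_assoc (Y ^ 2), ← smul_mul_assoc, ← hXY2]
  have hι : ιb = kronCol (cbs • 1) T := by rw [hιb, hT]; rfl
  have hτ : τb = kronRow (-(1 / cbs) • T) 1 := by rw [hτb, hT]; rfl
  have hzc : zs * cbs = κ₀ * ys * q := by rw [hcbs]; field_simp
  have hκc : κ₁ * xs * cbs = q * zs := by
    rw [hcbs]
    field_simp
    linear_combination -hzs
  obtain rfl : κ₀ = zs * cbs / (ys * q) := by field_simp; linear_combination -hzc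
  obtain rfl : κ₁ = q * zs / (xs * cbs) := by field_simp; linear_combination hκc
  clear hιb hτb hcbs hzs
  subst hι hτ hπe₀ hπe₁ hπt₀ hπt₁
  simp only [hρbe₀, hρbe₁, hρbt₀, hρbt₁, Matrix.add_mul, Matrix.mul_add, kronecker_mul_kronCol,
    kronRow_mul_kronecker, kronCol_mul, mul_kronRow, kronCol_add, kronRow_add]
  refine ⟨⟨?_, ?_, ?_, ?_⟩, ⟨?_, ?_, ?_, ?_⟩, injective_mulVecLin_kronCol_smul_one T hc0,
    surjective_mulVecLin_kronRow_one _, ker_mulVecLin_kronRow_eq_range_kronCol T hc0⟩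
  all_goals
    congr 1 <;>
    simp only [Matrix.of_apply, Matrix.cons_val', Matrix.cons_val_zero, Matrix.cons_val_one,
      Matrix.cons_val_fin_one, Matrix.one_apply, ↓reduceIte, zero_ne_one,
      one_ne_zero, mul_one, one_mul, smul_mul_assoc, mul_smul_comm,
      hWT, hTW, hZT, hTZ, hXT, hTY] <;>
    match_scalars <;> try field_simp
  all_goals ring
end

section
/- Let N ≥ 3 be odd, q ∈ ℂ a primitive N-th root of unity, and let X, Z be invertible N×N complex matrices with Z·X = q·X·Z and X^N = Z^N = 1. On ℂ^N ⊗ ℂ^N set X₁ := X ⊗ 1, X₂ := 1 ⊗ X, Z₁ := Z ⊗ 1, Z₂ := 1 ⊗ Z and χ := X⁻¹ ⊗ X. For 2×2 complex matrices A, B and i ∈ {1,2} let {A,B}ᵢ := diag(Xᵢ⁻¹,1)·A·diag(Zᵢ⁻¹,Zᵢ)·B·diag(Xᵢ,1), a 2×2 block matrix with blocks in End(ℂ^N ⊗ ℂ^N). Let x_a, y_a, μ_a ∈ ℂ for a ∈ {r, r', s, s'}, κ₀, κ₁, z ∈ ℂ, with U_a(z) := [[z, κ₀ x_a μ_a],[κ₁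 y_a, z μ_a]] and V_a(z) := [[−qz, κ₀ y_a],[q κ₁ x_a μ_a, −z μ_a]]. Suppose Ŵ : ZMod N → ℂ satisfies (μ_s x_s − μ_{r'} x_{r'} q^{2n})·Ŵ(n) = (μ_s y_{r'} − μ_{r'} y_s q^{2(n−1)})·Ŵ(n−1) for every n ∈ ZMod N, and set S := ∑_{n=0}^{N-1} Ŵ(n) χ^n. Then diag(S,S)·{U_r(z), V_{r'}(z)}₁·{U_s(z), V_{s'}(z)}₂ = {U_r(z), V_s(z)}₁·{U_{r'}(z), V_{s'}(z)}₂·diag(S,S) as 2×2 block matrices with blocks in End(ℂ^N ⊗ ℂ^N). -/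
open Matrix Kronecker

noncomputable section

/-- `E₀₀`, the elementary 2×2 matrix picking out the first component. -/
def E00 : Matrix (Fin 2) (Fin 2) ℂ := !![1, 0; 0, 0]

/-- `E₁₁`, the elementary 2×2 matrix picking out the second component. -/
def E11 : Matrix (Fin 2) (Fin 2) ℂ := !![0, 0; 0, 1]

/-- The bracket `{A,B}ᵢ = diag(Xᵢ⁻¹,1)·A·diag(Zᵢ⁻¹,Zᵢ)·B·diag(Xᵢ,1)` of (eq:ABnotn),
realized as an operator on `(ℂ^N ⊗ ℂ^N) ⊗ ℂ²`. -/
def bra {m : Type*} [Fintype m] [DecidableEq m] (X Z : Matrix m m ℂ)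
    (A B : Matrix (Fin 2) (Fin 2) ℂ) : Matrix (m × Fin 2) (m × Fin 2) ℂ :=
  (X⁻¹ ⊗ₖ E00 + (1 : Matrix m m ℂ) ⊗ₖ E11) * ((1 : Matrix m m ℂ) ⊗ₖ A) *
    (Z⁻¹ ⊗ₖ E00 + Z ⊗ₖ E11) * ((1 : Matrix m m ℂ) ⊗ₖ B) *
    (X ⊗ₖ E00 + (1 : Matrix m m ℂ) ⊗ₖ E11)

section IntertwinerHelpers

variable {m : Type*}

/-- The operator on `m × Fin 2` with the four given blocks. -/
def blk (a b c d : Matrix m m ℂ) : Matrix (m × Fin 2) (m × Fin 2) ℂ :=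
  Matrix.of fun i j => (!![a, b; c, d] i.2 j.2) i.1 j.1

theorem blk_mul [Fintype m] (a b c d a' b' c' d' : Matrix m m ℂ) :
    blk a b c d * blk a' b' c' d' =
      blk (a * a' + b * c') (a * b' + b * d') (c * a' + d * c') (c * b' + d * d') := by
  ext ⟨i, k⟩ ⟨j, l⟩
  fin_cases k <;> fin_cases l <;>
    simp [blk, Matrix.mul_apply, Fintype.sum_prod_type, Fin.sum_univ_two, Finset.sum_add_distrib]

theorem diag_eq_blk (a b : Matrix m m ℂ) : a ⊗ₖ E00 + b ⊗ₖ E11 = blk a 0 0 b := by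
  ext ⟨i, k⟩ ⟨j, l⟩
  fin_cases k <;> fin_cases l <;> simp [blk, E00, E11]

theorem one_kronecker_eq_blk [DecidableEq m] (a b c d : ℂ) :
    (1 : Matrix m m ℂ) ⊗ₖ !![a, b; c, d] = blk (a • 1) (b • 1) (c • 1) (d • 1) := by
  ext ⟨i, k⟩ ⟨j, l⟩
  fin_cases k <;> fin_cases l <;> simp [blk, mul_comm]

theorem kronecker_one_eq_blk (a : Matrix m m ℂ) :
    a ⊗ₖ (1 : Matrix (Fin 2) (Fin 2) ℂ) = blk a 0 0 a := by
  ext ⟨i, k⟩ ⟨j, l⟩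
  fin_cases k <;> fin_cases l <;> simp [blk]

variable [Fintype m] [DecidableEq m]

theorem commute_kronecker_one_diag {S a b : Matrix m m ℂ} (ha : Commute S a) (hb : Commute S b) :
    Commute (S ⊗ₖ (1 : Matrix (Fin 2) (Fin 2) ℂ)) (a ⊗ₖ E00 + b ⊗ₖ E11) := by
  rw [diag_eq_blk, kronecker_one_eq_blk, Commute, SemiconjBy, blk_mul, blk_mul]
  simp [ha.eq, hb.eq]

theorem commute_kronecker_one_one_kronecker (S : Matrix m m ℂ) (A : Matrix (Fin 2) (Fin 2) ℂ) :
    Commute (S ⊗ₖ (1 : Matrix (Fin 2) (Fin 2) ℂ)) ((1 : Matrix m m ℂ) ⊗ₖ A) := by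
  rw [Commute, SemiconjBy, ← mul_kronecker_mul, ← mul_kronecker_mul]
  simp

theorem pow_val_eq_mul_pow_val_sub_one {M : Type*} [Monoid M] {N : ℕ} [NeZero N] {h : M}
    (hN : h ^ N = 1) (n : ZMod N) : h ^ n.val = h * h ^ (n - 1).val := by
  rw [← pow_succ', pow_eq_pow_mod ((n - 1).val + 1) hN]
  congr 1
  conv_lhs => rw [← sub_add_cancel n 1]
  rw [ZMod.val_add, ZMod.val_one_eq_one_mod, Nat.add_mod_mod]

/-- The operator `∑ n, W n (cχ)ⁿ`. -/
def twistedSum {A : Type*} [Ring A] [Algebra ℂ A] {N : ℕ} [NeZero N] (W : ZMod N → ℂ) (χ : A)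
    (c : ℂ) : A :=
  ∑ n : ZMod N, (W n * c ^ n.val) • χ ^ n.val

section TwistedSum

variable {A : Type*} [Ring A] [Algebra ℂ A] {N : ℕ} [NeZero N] (W : ZMod N → ℂ) {χ : A}

theorem mul_pow_of_mul_eq_smul_s11 {Y : A} {c : ℂ} (h : Y * χ = c • (χ * Y)) (n : ℕ) :
    Y * χ ^ n = c ^ n • (χ ^ n * Y) := by
  induction n with
  | zero => simp
  | succ k ih =>
    rw [pow_succ, ← mul_assoc, ih, smul_mul_assoc, mul_assoc, h, mul_smul_comm, smul_smul,
      mul_assoc, pow_succ]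

theorem pow_mul_of_mul_eq_smul_s11 {Y : A} {c : ℂ} (h : χ * Y = c • (Y * χ)) (n : ℕ) :
    χ ^ n * Y = c ^ n • (Y * χ ^ n) := by
  induction n with
  | zero => simp
  | succ k ih =>
    rw [pow_succ, mul_assoc, h, mul_smul_comm, ← mul_assoc, ih, smul_mul_assoc, smul_smul,
      mul_assoc, ← pow_succ', ← pow_succ]

theorem mul_twistedSum_one {Y : A} {c : ℂ} (h : Y * χ = c • (χ * Y)) :
    Y * twistedSum W χ 1 = twistedSum W χ c * Y := by
  simp only [twistedSum, Finset.mul_sum, Finset.sum_mul]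
  refine Finset.sum_congr rfl fun n _ => ?_
  rw [mul_smul_comm, mul_pow_of_mul_eq_smul_s11 h, smul_smul, smul_mul_assoc]
  simp

theorem twistedSum_one_mul {Y : A} {c : ℂ} (h : χ * Y = c • (Y * χ)) :
    twistedSum W χ 1 * Y = Y * twistedSum W χ c := by
  simp only [twistedSum, Finset.mul_sum, Finset.sum_mul]
  refine Finset.sum_congr rfl fun n _ => ?_
  rw [smul_mul_assoc, pow_mul_of_mul_eq_smul_s11 h, smul_smul, mul_smul_comm]
  simp

theorem commute_twistedSum {Y : A} (h : Commute χ Y) (c : ℂ) : Commute (twistedSum W χ c) Y :=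
  Commute.sum_left _ _ _ fun _ _ => (h.pow_left _).smul_left _

theorem twistedSum_mul_affine {C : A} (hC : χ * C = 1) (hχ : χ ^ N = 1) (c α β : ℂ) :
    twistedSum W χ c * (α • C + β • 1) =
      ∑ n : ZMod N, (α * W n * c ^ n.val + β * W (n - 1) * c ^ (n - 1).val) •
        χ ^ (n - 1).val := by
  simp only [add_smul, Finset.sum_add_distrib, mul_add, twistedSum, Finset.sum_mul]
  congr 1
  · refine Finset.sum_congr rfl fun n _ => ?_
    rw [pow_val_eq_mul_pow_val_sub_one hχ n, ← pow_succ', pow_succ, smul_mul_smul_comm,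
      mul_assoc (χ ^ _), hC, mul_one]
    congr 1
    ring
  · rw [← Equiv.sum_comp (Equiv.subRight (1 : ZMod N))]
    refine Finset.sum_congr rfl fun n _ => ?_
    rw [Equiv.subRight_apply, smul_mul_smul_comm, mul_one]
    congr 1
    ring

theorem twistedSum_inv_mul_affine {C : A} (hC : χ * C = 1) (hχ : χ ^ N = 1) {q : ℂ}
    (hq : q ^ N = 1) {a b d e : ℂ}
    (hrec : ∀ n : ZMod N,
      (a - b * (q ^ 2) ^ n.val) * W n = (d - e * (q ^ 2) ^ (n - 1).val) * W (n - 1)) :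
    twistedSum W χ q⁻¹ * ((-(q * a)) • C + d • 1) =
      twistedSum W χ q * ((-(q * b)) • C + e • 1) := by
  have hq0 : q ≠ 0 := fun h => by simp [h, NeZero.ne N] at hq
  rw [twistedSum_mul_affine W hC hχ, twistedSum_mul_affine W hC hχ]
  refine Finset.sum_congr rfl fun n _ => ?_
  congr 1
  have h := hrec n
  rw [← pow_mul, ← pow_mul, mul_comm 2, mul_comm 2, pow_mul, pow_mul,
    pow_val_eq_mul_pow_val_sub_one hq n] at h
  rw [inv_pow, inv_pow, pow_val_eq_mul_pow_val_sub_one hq n]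
  have hp : q ^ (n - 1).val ≠ 0 := pow_ne_zero _ hq0
  generalize q ^ (n - 1).val = p at *
  field_simp
  linear_combination -h

end TwistedSum

theorem intertwine_middle {S Sm Sp Y₁ Y₁' Y₂ Y₂' C : Matrix m m ℂ}
    (h₁ : S * Y₁' = Y₁' * Sm) (h₂ : S * Y₁ = Y₁ * Sp)
    (h₃ : Y₂' * S = Sm * Y₂') (h₄ : Y₂ * S = Sp * Y₂)
    (hCm : Commute Sm C) (hCp : Commute Sp C)
    {q z κ₀ κ₁ x y μ x' y' μ' : ℂ}
    (hk : Sm * ((-(q * (μ * x))) • C + (μ * y') • 1) =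
      Sp * ((-(q * (μ' * x'))) • C + (μ' * y) • 1)) :
    (S ⊗ₖ (1 : Matrix (Fin 2) (Fin 2) ℂ)) *
      ((Y₁' ⊗ₖ E00 + Y₁ ⊗ₖ E11) *
        ((1 : Matrix m m ℂ) ⊗ₖ !![-(q * z), κ₀ * y'; q * κ₁ * x' * μ', -(z * μ')]) *
        (C ⊗ₖ E00 + 1 ⊗ₖ E11) *
        ((1 : Matrix m m ℂ) ⊗ₖ !![z, κ₀ * x * μ; κ₁ * y, z * μ]) *
        (Y₂' ⊗ₖ E00 + Y₂ ⊗ₖ E11)) =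
      ((Y₁' ⊗ₖ E00 + Y₁ ⊗ₖ E11) *
        ((1 : Matrix m m ℂ) ⊗ₖ !![-(q * z), κ₀ * y; q * κ₁ * x * μ, -(z * μ)]) *
        (C ⊗ₖ E00 + 1 ⊗ₖ E11) *
        ((1 : Matrix m m ℂ) ⊗ₖ !![z, κ₀ * x' * μ'; κ₁ * y', z * μ']) *
        (Y₂' ⊗ₖ E00 + Y₂ ⊗ₖ E11)) * (S ⊗ₖ (1 : Matrix (Fin 2) (Fin 2) ℂ)) := by
  have key : ∀ {Y Y' T T' P P' : Matrix m m ℂ}, S * Y = Y * T → Y' * S = T' * Y' →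
      T * P = P' * T' → S * (Y * P * Y') = Y * P' * Y' * S := by
    intro Y Y' T T' P P' h h' hP
    calc S * (Y * P * Y') = (S * Y) * P * Y' := by noncomm_ring
      _ = Y * (T * P) * Y' := by rw [h]; noncomm_ring
      _ = Y * P' * (Y' * S) := by rw [hP, h']; noncomm_ring
      _ = Y * P' * Y' * S := by noncomm_ring
  have aff : ∀ {T : Matrix m m ℂ}, Commute T C → ∀ α β : ℂ,
      T * (α • C + β • 1) = (α • C + β • 1) * T := fun h α β =>
    ((h.smul_right α).add_right ((Commute.one_right _).smul_right β)).eq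
  have e₀₀ := key h₁ h₃ (aff hCm (-(q * z) * z) (κ₀ * y' * (κ₁ * y)))
  have e₁₁ := key h₂ h₄ (aff hCp (q * κ₁ * x' * μ' * (κ₀ * x * μ)) (-(z * μ') * (z * μ)))
  have e₀₁ := key h₁ h₄ (hk.trans (aff hCp _ _))
  have e₁₀ := key h₂ h₃ (hk.symm.trans (aff hCm _ _))
  simp only [diag_eq_blk, one_kronecker_eq_blk, kronecker_one_eq_blk, blk_mul, mul_zero, zero_mul,
    add_zero, zero_add, mul_one, smul_mul_assoc, mul_smul_comm, smul_smul, mul_add,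
    add_mul, smul_add, mul_assoc] at e₀₀ e₁₁ e₀₁ e₁₀ ⊢
  congr 1
  · linear_combination (norm := module) e₀₀
  · linear_combination (norm := module) (κ₀ * z) • e₀₁
  · linear_combination (norm := module) (-(κ₁ * z)) • e₁₀
  · linear_combination (norm := module) e₁₁

theorem bra_mul_bra (X₁ Z₁ X₂ Z₂ : Matrix m m ℂ) (A B A' B' : Matrix (Fin 2) (Fin 2) ℂ) :
    bra X₁ Z₁ A B * bra X₂ Z₂ A' B' =
      ((X₁⁻¹ ⊗ₖ E00 + 1 ⊗ₖ E11) * ((1 : Matrix m m ℂ) ⊗ₖ A)) *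
        ((Z₁⁻¹ ⊗ₖ E00 + Z₁ ⊗ₖ E11) * ((1 : Matrix m m ℂ) ⊗ₖ B) *
          ((X₁ * X₂⁻¹) ⊗ₖ E00 + 1 ⊗ₖ E11) * ((1 : Matrix m m ℂ) ⊗ₖ A') *
          (Z₂⁻¹ ⊗ₖ E00 + Z₂ ⊗ₖ E11)) *
        (((1 : Matrix m m ℂ) ⊗ₖ B') * (X₂ ⊗ₖ E00 + 1 ⊗ₖ E11)) := by
  have h : ((X₁ * X₂⁻¹) ⊗ₖ E00 + 1 ⊗ₖ E11 : Matrix (m × Fin 2) (m × Fin 2) ℂ) =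
      (X₁ ⊗ₖ E00 + 1 ⊗ₖ E11) * (X₂⁻¹ ⊗ₖ E00 + 1 ⊗ₖ E11) := by
    simp only [diag_eq_blk, blk_mul]
    simp
  rw [h, bra, bra]
  simp only [mul_assoc]

theorem Commute.mul_mul_eq {R : Type*} [Semigroup R] {T a b k k' : R} (ha : Commute T a)
    (hb : Commute T b) (h : T * k = k' * T) : T * (a * k * b) = a * k' * b * T := by
  rw [← mul_assoc, ← mul_assoc, ha.eq, mul_assoc a, h, mul_assoc, mul_assoc k', hb.eq]
  simp only [mul_assoc]

end IntertwinerHelpers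

/-- Proposition (LLproperties)(ii): the operator `S_{r's}` intertwines
`Ľ_{Ω_{rr'}}(z) ⊗ Ľ_{Ω_{ss'}}(z)` with `Ľ_{Ω_{rs}}(z) ⊗ Ľ_{Ω_{r's'}}(z)`. -/
theorem stmt_11 (N : ℕ) [NeZero N] (hN : 3 ≤ N) (hNodd : Odd N)
    (q : ℂ) (hq : IsPrimitiveRoot q N)
    (X Z : Matrix (Fin N) (Fin N) ℂ) (hXu : IsUnit X) (hZu : IsUnit Z)
    (hZX : Z * X = q • (X * Z)) (hXN : X ^ N = 1) (hZN : Z ^ N = 1)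
    (xr yr μr xr' yr' μr' xs ys μs xs' ys' μs' κ₀ κ₁ z : ℂ)
    (What : ZMod N → ℂ)
    (hrec : ∀ n : ZMod N,
      (μs * xs - μr' * xr' * (q ^ 2) ^ n.val) * What n
        = (μs * yr' - μr' * ys * (q ^ 2) ^ (n - 1).val) * What (n - 1)) :
    ((∑ n : ZMod N, What n • (X⁻¹ ⊗ₖ X) ^ n.val) ⊗ₖ (1 : Matrix (Fin 2) (Fin 2) ℂ)) *
        bra (X ⊗ₖ (1 : Matrix (Fin N) (Fin N) ℂ)) (Z ⊗ₖ (1 : Matrix (Fin N) (Fin N) ℂ))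
          !![z, κ₀ * xr * μr; κ₁ * yr, z * μr]
          !![-(q * z), κ₀ * yr'; q * κ₁ * xr' * μr', -(z * μr')] *
        bra ((1 : Matrix (Fin N) (Fin N) ℂ) ⊗ₖ X) ((1 : Matrix (Fin N) (Fin N) ℂ) ⊗ₖ Z)
          !![z, κ₀ * xs * μs; κ₁ * ys, z * μs]
          !![-(q * z), κ₀ * ys'; q * κ₁ * xs' * μs', -(z * μs')]
      = bra (X ⊗ₖ (1 : Matrix (Fin N) (Fin N) ℂ)) (Z ⊗ₖ (1 : Matrix (Fin N) (Fin N) ℂ))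
          !![z, κ₀ * xr * μr; κ₁ * yr, z * μr]
          !![-(q * z), κ₀ * ys; q * κ₁ * xs * μs, -(z * μs)] *
        bra ((1 : Matrix (Fin N) (Fin N) ℂ) ⊗ₖ X) ((1 : Matrix (Fin N) (Fin N) ℂ) ⊗ₖ Z)
          !![z, κ₀ * xr' * μr'; κ₁ * yr', z * μr']
          !![-(q * z), κ₀ * ys'; q * κ₁ * xs' * μs', -(z * μs')] *
        ((∑ n : ZMod N, What n • (X⁻¹ ⊗ₖ X) ^ n.val) ⊗ₖ (1 : Matrix (Fin 2) (Fin 2) ℂ)) := by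
  have hX := (Matrix.isUnit_iff_isUnit_det X).1 hXu
  have hZ := (Matrix.isUnit_iff_isUnit_det Z).1 hZu
  have hqN : q ^ N = 1 := hq.pow_eq_one
  have hq0 : q ≠ 0 := hq.ne_zero (NeZero.ne N)
  have hXZ' : X⁻¹ * Z = q • (Z * X⁻¹) := by
    calc X⁻¹ * Z = X⁻¹ * (Z * X) * X⁻¹ := by
          rw [mul_assoc, mul_assoc, Matrix.mul_nonsing_inv _ hX, mul_one]
      _ = q • (Z * X⁻¹) := by
          rw [hZX, mul_smul_comm, ← mul_assoc, Matrix.nonsing_inv_mul _ hX, one_mul,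
            smul_mul_assoc]
  have hZ'X : Z⁻¹ * X = q⁻¹ • (X * Z⁻¹) := by
    rw [eq_inv_smul_iff₀ hq0]
    calc q • (Z⁻¹ * X) = Z⁻¹ * (q • (X * Z)) * Z⁻¹ := by
          rw [mul_smul_comm, smul_mul_assoc, mul_assoc, mul_assoc, Matrix.mul_nonsing_inv _ hZ,
            mul_one]
      _ = X * Z⁻¹ := by
          rw [← hZX, ← mul_assoc, Matrix.nonsing_inv_mul _ hZ, one_mul]
  have hX'Z' : X⁻¹ * Z⁻¹ = q⁻¹ • (Z⁻¹ * X⁻¹) := by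
    rw [eq_inv_smul_iff₀ hq0]
    calc q • (X⁻¹ * Z⁻¹) = Z⁻¹ * (q • (Z * X⁻¹)) * Z⁻¹ := by
          rw [mul_smul_comm, smul_mul_assoc, ← mul_assoc, Matrix.nonsing_inv_mul _ hZ, one_mul]
      _ = Z⁻¹ * X⁻¹ := by
          rw [← hXZ', mul_assoc, mul_assoc, Matrix.mul_nonsing_inv _ hZ, mul_one]
  set χ := X⁻¹ ⊗ₖ X with hχ
  have hS : (∑ n : ZMod N, What n • χ ^ n.val) = twistedSum What χ 1 := by
    simp [twistedSum]
  have hXX' : Commute X⁻¹ X := (Matrix.nonsing_inv_mul _ hX).trans (Matrix.mul_nonsing_inv _ hX).symm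
  have hkp : ∀ (B D : Matrix (Fin N) (Fin N) ℂ) (n : ℕ), (B ⊗ₖ D) ^ n = (B ^ n) ⊗ₖ (D ^ n) := by
    intro B D n
    induction n with
    | zero => simp
    | succ k ih => rw [pow_succ, ih, ← mul_kronecker_mul, pow_succ, pow_succ]
  have hχN : χ ^ N = 1 := by
    rw [hχ, hkp, Matrix.inv_pow', hXN]
    simp
  have hχ₁ : Commute χ (X ⊗ₖ (1 : Matrix (Fin N) (Fin N) ℂ)) := by
    rw [Commute, SemiconjBy, ← mul_kronecker_mul, ← mul_kronecker_mul, hXX'.eq, mul_one, one_mul]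
  have hχ₁' : Commute χ (X⁻¹ ⊗ₖ (1 : Matrix (Fin N) (Fin N) ℂ)) := by
    rw [Commute, SemiconjBy, ← mul_kronecker_mul, ← mul_kronecker_mul, mul_one, one_mul]
  have hχ₂ : Commute χ ((1 : Matrix (Fin N) (Fin N) ℂ) ⊗ₖ X) := by
    rw [Commute, SemiconjBy, ← mul_kronecker_mul, ← mul_kronecker_mul, mul_one, one_mul]
  have hχC : Commute χ (X ⊗ₖ X⁻¹) := by
    rw [Commute, SemiconjBy, ← mul_kronecker_mul, ← mul_kronecker_mul, hXX'.eq]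
  have hC : χ * (X ⊗ₖ X⁻¹) = 1 := by
    rw [hχ, ← mul_kronecker_mul, Matrix.nonsing_inv_mul _ hX, Matrix.mul_nonsing_inv _ hX,
      one_kronecker_one]
  rw [hS, mul_assoc, bra_mul_bra, bra_mul_bra, inv_kronecker, inv_kronecker, inv_kronecker,
    inv_kronecker, inv_one, ← mul_kronecker_mul, mul_one, one_mul]
  refine Commute.mul_mul_eq ?_ ?_ (intertwine_middle (Sm := twistedSum What χ q⁻¹)
    (Sp := twistedSum What χ q) ?_ ?_ ?_ ?_ ?_ ?_ ?_)
  · exact (commute_kronecker_one_diag (commute_twistedSum What hχ₁' 1)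
      (Commute.one_right _)).mul_right (commute_kronecker_one_one_kronecker _ _)
  · exact (commute_kronecker_one_one_kronecker _ _).mul_right
      (commute_kronecker_one_diag (commute_twistedSum What hχ₂ 1) (Commute.one_right _))
  · refine twistedSum_one_mul What ?_
    rw [hχ, ← mul_kronecker_mul, ← mul_kronecker_mul, hX'Z', smul_kronecker, mul_one, one_mul]
  · refine twistedSum_one_mul What ?_
    rw [hχ, ← mul_kronecker_mul, ← mul_kronecker_mul, hXZ', smul_kronecker, mul_one, one_mul]
  · refine mul_twistedSum_one What ?_
    rw [hχ, ← mul_kronecker_mul, ← mul_kronecker_mul, hZ'X, kronecker_smul, mul_one, one_mul]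
  · refine mul_twistedSum_one What ?_
    rw [hχ, ← mul_kronecker_mul, ← mul_kronecker_mul, hZX, kronecker_smul, mul_one, one_mul]
  · exact commute_twistedSum What hχC _
  · exact commute_twistedSum What hχC _
  · exact twistedSum_inv_mul_affine What hC hχN hqN hrec

end
end

section
/- Let N ≥ 3 be odd, q ∈ ℂ a primitive N-th root of unity, and let X, Z be invertible N×N complex matrices with Z·X = q·X·Z and X^N = Z^N = 1. Let x_r, y_r, μ_r, κ₀, κ₁ ∈ ℂ and z, w ∈ ℂ nonzero. Let Ř(u) be the 4×4 matrix on ℂ² ⊗ ℂ² with Ř(u)·(u₀⊗u₀) = a(u)·u₀⊗u₀, Ř(u)·(u₁⊗u₁) = a(u)·u₁⊗u₁, Ř(u)·(u₀⊗u₁) = c(u)·u₀⊗u₁ + b(u)·u₁⊗u₀, Ř(u)·(u₁⊗u₀) = b(u)·u₀⊗u₁ + c(u)·u₁⊗u₀, where a(u) = 1 − q²u², b(u) = q(1 − u²), c(u) = u(1 − q²), and set R(u) := P∘Ř(u) with P the flip of ℂ² ⊗ ℂ². With {A,B} := diag(X⁻¹,1)·A·diag(Z⁻¹,Z)·B·diag(X,1)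 ∈ End(ℂ^N ⊗ ℂ²), U_r(z) := [[z, κ₀ x_r μ_r],[κ₁ y_r, z μ_r]], V_r(z) := [[−qz, κ₀ y_r],[q κ₁ x_r μ_r, −z μ_r]], let L(z) be either {U_r(z), 1₂} or {V_r(z), 1₂}. Then, in End(ℂ^N ⊗ ℂ² ⊗ ℂ²), R₂₃(z/w)·L₁₃(w)·L₁₂(z) = L₁₂(z)·L₁₃(w)·R₂₃(z/w), where the subscripts indicate the tensor factors on which the operators act (identity on the remaining factor). -/
open Matrix Kronecker

noncomputable section

/-- The 6-vertex model Ř-matrix (eq:Rmatrix) with entries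
`a(u) = 1−q²u²`, `b(u) = q(1−u²)`, `c(u) = u(1−q²)`. -/
def Rcheck (q u : ℂ) : Matrix (Fin 2 × Fin 2) (Fin 2 × Fin 2) ℂ :=
  Matrix.of fun p p' =>
    if p = p' then (if p.1 = p.2 then 1 - q ^ 2 * u ^ 2 else u * (1 - q ^ 2))
    else if p.1 = p'.2 ∧ p.2 = p'.1 then q * (1 - u ^ 2) else 0

/-- The flip operator on `ℂ² ⊗ ℂ²`. -/
def flip2 : Matrix (Fin 2 × Fin 2) (Fin 2 × Fin 2) ℂ :=
  Matrix.of fun p p' => if p.1 = p'.2 ∧ p.2 = p'.1 then 1 else 0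

/-- `L₁₂`: an operator on `ℂ^N ⊗ ℂ²` acting on the first two factors of
`ℂ^N ⊗ ℂ² ⊗ ℂ²`. -/
def op12 {N : ℕ} (L : Matrix (Fin N × Fin 2) (Fin N × Fin 2) ℂ) :
    Matrix (Fin N × Fin 2 × Fin 2) (Fin N × Fin 2 × Fin 2) ℂ :=
  Matrix.of fun p p' =>
    L (p.1, p.2.1) (p'.1, p'.2.1) * (if p.2.2 = p'.2.2 then 1 else 0)

/-- `L₁₃`: an operator on `ℂ^N ⊗ ℂ²` acting on the first and third factors of
`ℂ^N ⊗ ℂ² ⊗ ℂ²`. -/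
def op13 {N : ℕ} (L : Matrix (Fin N × Fin 2) (Fin N × Fin 2) ℂ) :
    Matrix (Fin N × Fin 2 × Fin 2) (Fin N × Fin 2 × Fin 2) ℂ :=
  Matrix.of fun p p' =>
    L (p.1, p.2.2) (p'.1, p'.2.2) * (if p.2.1 = p'.2.1 then 1 else 0)

/-- The operator on `V ⊗ ℂ²` with blocks `S i j`. -/
def ofBlocks {m : Type*} (S : Matrix (Fin 2) (Fin 2) (Matrix m m ℂ)) : Matrix (m × Fin 2) (m × Fin 2) ℂ :=
  Matrix.of fun p p' => S p.2 p'.2 p.1 p'.1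

theorem op13_mul_op12_apply {N : ℕ} (S T : Matrix (Fin 2) (Fin 2) (Matrix (Fin N) (Fin N) ℂ))
    (i j : Fin N) (a b c d : Fin 2) :
    (op13 (ofBlocks S) * op12 (ofBlocks T)) (i, a, b) (j, c, d) = (S b d * T a c) i j := by
  simp only [mul_apply, Fintype.sum_prod_type, op12, op13, ofBlocks, of_apply]
  refine Finset.sum_congr rfl fun k _ => ?_
  simp

theorem op12_mul_op13_apply {N : ℕ} (S T : Matrix (Fin 2) (Fin 2) (Matrix (Fin N) (Fin N) ℂ))
    (i j : Fin N) (a b c d : Fin 2) :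
    (op12 (ofBlocks T) * op13 (ofBlocks S)) (i, a, b) (j, c, d) = (T a c * S b d) i j := by
  simp only [mul_apply, Fintype.sum_prod_type, op12, op13, ofBlocks, of_apply]
  refine Finset.sum_congr rfl fun k _ => ?_
  simp

theorem one_kronecker_mul_apply {m n : Type*} [Fintype m] [DecidableEq m] [Fintype n]
    (R : Matrix n n ℂ) (M : Matrix (m × n) (m × n) ℂ) (i j : m) (s t : n) :
    ((1 : Matrix m m ℂ) ⊗ₖ R * M) (i, s) (j, t) = ∑ r, R s r * M (i, r) (j, t) := by
  simp [mul_apply, Fintype.sum_prod_type, kroneckerMap_apply, one_apply]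

theorem mul_one_kronecker_apply {m n : Type*} [Fintype m] [DecidableEq m] [Fintype n]
    (R : Matrix n n ℂ) (M : Matrix (m × n) (m × n) ℂ) (i j : m) (s t : n) :
    (M * (1 : Matrix m m ℂ) ⊗ₖ R) (i, s) (j, t) = ∑ r, M (i, s) (j, r) * R r t := by
  simp [mul_apply, Fintype.sum_prod_type, kroneckerMap_apply, one_apply]

theorem flip2_mul_apply (M : Matrix (Fin 2 × Fin 2) (Fin 2 × Fin 2) ℂ) (a b : Fin 2)
    (t : Fin 2 × Fin 2) : (flip2 * M) (a, b) t = M (b, a) t := by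
  fin_cases a <;> fin_cases b <;> simp [flip2, mul_apply, Fintype.sum_prod_type]

/-- The 6-vertex `R`-matrix intertwines two L-operators whose diagonal blocks are proportional to
the spectral parameter and whose blocks `q`-commute. -/
theorem rll_ofBlocks {N : ℕ} (q z w : ℂ) (hw : w ≠ 0)
    (A B C D : Matrix (Fin N) (Fin N) ℂ) (hAB : A * B = q • (B * A)) (hCA : C * A = q • (A * C))
    (hBD : B * D = q • (D * B)) (hDC : D * C = q • (C * D)) (hAD : A * D = D * A)
    (hBC : B * C = C * B) :
    ((1 : Matrix (Fin N) (Fin N) ℂ) ⊗ₖ (flip2 * Rcheck q (z / w))) *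
        op13 (ofBlocks !![w • A, B; C, w • D]) * op12 (ofBlocks !![z • A, B; C, z • D])
      = op12 (ofBlocks !![z • A, B; C, z • D]) * op13 (ofBlocks !![w • A, B; C, w • D]) *
        ((1 : Matrix (Fin N) (Fin N) ℂ) ⊗ₖ (flip2 * Rcheck q (z / w))) := by
  ext ⟨i, a, b⟩ ⟨j, c, d⟩
  have hAB' := congr_fun₂ hAB i j
  have hCA' := congr_fun₂ hCA i j
  have hBD' := congr_fun₂ hBD i j
  have hDC' := congr_fun₂ hDC i j
  simp only [Matrix.smul_apply, smul_eq_mul] at hAB' hCA' hBD' hDC'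
  rw [Matrix.mul_assoc, one_kronecker_mul_apply, mul_one_kronecker_apply]
  simp only [op13_mul_op12_apply, op12_mul_op13_apply, flip2_mul_apply, Fintype.sum_prod_type,
    Fin.sum_univ_two]
  fin_cases a <;> fin_cases b <;> fin_cases c <;> fin_cases d <;>
    simp [Rcheck, hAB', hCA', hBD', hDC', hAD, hBC] <;> field_simp <;> ring

theorem bra_eq_ofBlocks {m : Type*} [Fintype m] [DecidableEq m] (X Z : Matrix m m ℂ)
    (a b c d : ℂ) :
    bra X Z !![a, b; c, d] 1 =
      ofBlocks !![a • (X⁻¹ * Z⁻¹ * X), b • (X⁻¹ * Z); c • (Z⁻¹ * X), d • Z] := by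
  have hM (M : Matrix (Fin 2) (Fin 2) ℂ) : M = M 0 0 • E00 + M 0 1 • !![0, 1; 0, 0]
      + M 1 0 • !![0, 0; 1, 0] + M 1 1 • E11 := by
    ext i j; fin_cases i <;> fin_cases j <;> simp [E00, E11]
  rw [bra, one_kronecker_one, Matrix.mul_one, hM !![a, b; c, d]]
  simp only [kronecker_add, kronecker_smul, add_mul, mul_add, ← mul_kronecker_mul, Matrix.mul_smul,
    Matrix.smul_mul, Matrix.mul_one, Matrix.one_mul]
  ext ⟨i, s⟩ ⟨j, t⟩
  fin_cases s <;> fin_cases t <;>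
    simp [E00, E11, ofBlocks, kroneckerMap_apply]

theorem nonsing_inv_mul_eq_smul {m : Type*} [Fintype m] [DecidableEq m] {q : ℂ} (hq : q ≠ 0)
    {A B : Matrix m m ℂ} (hA : IsUnit A.det) (h : A * B = q • (B * A)) :
    A⁻¹ * B = q⁻¹ • (B * A⁻¹) := by
  rw [← mul_nonsing_inv_cancel_right A (A⁻¹ * B) hA, mul_assoc A⁻¹ B A,
    ← inv_smul_smul₀ hq (B * A), ← h, Matrix.mul_smul, nonsing_inv_mul_cancel_left _ _ hA,
    Matrix.smul_mul]

/-- The RLL relation for the bracket of a matrix whose diagonal is proportional to the spectral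
parameter. -/
theorem rll_bra {N : ℕ} (q : ℂ) (hq : q ≠ 0) (X Z : Matrix (Fin N) (Fin N) ℂ) (hX : IsUnit X)
    (hZ : IsUnit Z) (hZX : Z * X = q • (X * Z)) (a b c d z w : ℂ) (hw : w ≠ 0) :
    ((1 : Matrix (Fin N) (Fin N) ℂ) ⊗ₖ (flip2 * Rcheck q (z / w))) *
        op13 (bra X Z !![a * w, b; c, d * w] 1) * op12 (bra X Z !![a * z, b; c, d * z] 1)
      = op12 (bra X Z !![a * z, b; c, d * z] 1) * op13 (bra X Z !![a * w, b; c, d * w] 1) *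
        ((1 : Matrix (Fin N) (Fin N) ℂ) ⊗ₖ (flip2 * Rcheck q (z / w))) := by
  have hX' := (isUnit_iff_isUnit_det X).mp hX
  have hZ' := (isUnit_iff_isUnit_det Z).mp hZ
  have hXZ : X * Z = q⁻¹ • (Z * X) := by rw [hZX, inv_smul_smul₀ hq]
  have hZiX : Z⁻¹ * X = q⁻¹ • (X * Z⁻¹) := nonsing_inv_mul_eq_smul hq hZ' hZX
  have hXiZ : X⁻¹ * Z = q • (Z * X⁻¹) := by
    simpa using nonsing_inv_mul_eq_smul (inv_ne_zero hq) hX' hXZ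
  have hXiZi : X⁻¹ * Z⁻¹ = q⁻¹ • (Z⁻¹ * X⁻¹) :=
    nonsing_inv_mul_eq_smul hq hX' (by rw [hZiX, smul_inv_smul₀ hq])
  have hXi : X⁻¹ * Z⁻¹ * X = q⁻¹ • Z⁻¹ := by
    rw [mul_assoc, hZiX, Matrix.mul_smul, nonsing_inv_mul_cancel_left _ _ hX']
  simp only [bra_eq_ofBlocks, hXi]
  simp only [mul_comm a, mul_comm d, mul_smul]
  apply rll_ofBlocks q z w hw
  all_goals simp only [Matrix.smul_mul, Matrix.mul_smul]
  · rw [hXiZ, Matrix.mul_smul, nonsing_inv_mul_cancel_left _ _ hZ', Matrix.smul_mul,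
      mul_assoc, hXiZi, Matrix.mul_smul, mul_nonsing_inv_cancel_left _ _ hZ']
    match_scalars
    field_simp
  · rw [mul_assoc, ← smul_inv_smul₀ hq (X * Z⁻¹), ← hZiX, Matrix.mul_smul]
    module
  · rw [hXiZ, Matrix.smul_mul, mul_assoc, hXiZ, Matrix.mul_smul]
    module
  · rw [mul_assoc, hXZ, Matrix.mul_smul, mul_nonsing_inv_cancel_left _ _ hZ',
      nonsing_inv_mul_cancel_left _ _ hZ']
    match_scalars
    field_simp
  · rw [mul_nonsing_inv _ hZ', nonsing_inv_mul _ hZ']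
    module
  · rw [mul_assoc, mul_assoc, mul_nonsing_inv_cancel_left _ _ hZ',
      mul_nonsing_inv_cancel_left _ _ hX', nonsing_inv_mul _ hX', nonsing_inv_mul _ hZ']
    module

/-- Proposition (RLL): the RLL relations for the L-operators `L_{ρ_r}` and `L_{ρ̄_r}`
with the 6-vertex R-matrix. -/
theorem stmt_12 (N : ℕ) (hN : 3 ≤ N) (hNodd : Odd N)
    (q : ℂ) (hq : IsPrimitiveRoot q N)
    (X Z : Matrix (Fin N) (Fin N) ℂ) (hXu : IsUnit X) (hZu : IsUnit Z)
    (hZX : Z * X = q • (X * Z)) (hXN : X ^ N = 1) (hZN : Z ^ N = 1)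
    (xr yr μr κ₀ κ₁ : ℂ) (z w : ℂ) (hz : z ≠ 0) (hw : w ≠ 0)
    (L : ℂ → Matrix (Fin N × Fin 2) (Fin N × Fin 2) ℂ)
    (hL : (∀ u, L u = bra X Z !![u, κ₀ * xr * μr; κ₁ * yr, u * μr] 1)
        ∨ (∀ u, L u = bra X Z !![-(q * u), κ₀ * yr; q * κ₁ * xr * μr, -(u * μr)] 1)) :
    ((1 : Matrix (Fin N) (Fin N) ℂ) ⊗ₖ (flip2 * Rcheck q (z / w))) *
        op13 (L w) * op12 (L z)
      = op12 (L z) * op13 (L w) *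
        ((1 : Matrix (Fin N) (Fin N) ℂ) ⊗ₖ (flip2 * Rcheck q (z / w))) := by
  have hq0 : q ≠ 0 := hq.ne_zero (by omega)
  rcases hL with hL | hL
  · convert rll_bra q hq0 X Z hXu hZu hZX 1 (κ₀ * xr * μr) (κ₁ * yr) μr z w hw using 4 <;>
      simp only [hL, one_mul, mul_comm μr]
  · convert rll_bra q hq0 X Z hXu hZu hZX (-q) (κ₀ * yr) (q * κ₁ * xr * μr) (-μr) z w hw
      using 4 <;>
      simp only [hL, neg_mul, mul_comm μr]

end
end

section
/- Let q, x_r, y_r, μ_r, x_s, y_s, μ_s, x_{s'}, y_{s'}, μ_{s'}, κ₀, κ₁ be nonzero complex numbers. For integers m ≥ 0, n ≥ 0, define Ŵ_{a,b}(m) := ∏_{j=1}^{m} (μ_b y_a − μ_a y_b q^{2(j−1)})/(μ_b x_b − μ_a x_a q^{2j}) and W̌_{a,b}(n) := ∏_{j=1}^{n} (y_b − x_a μ_a μ_b q^{2j})/(y_a − x_b μ_a μ_b q^{2j}), for parameter triples a = (x_a,y_a,μ_a), b = (x_b,y_b,μ_b); write rq := (q x_r, q y_r, q μ_r). Set E₁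 := μ_s κ₀κ₁ (q² x_r y_r − x_s y_s)(q² x_r μ_r μ_{s'} − y_{s'})/(μ_s x_s − μ_r x_r q²). Then for all integers m, ℓ ≥ 0 (assuming every factor appearing in a denominator is nonzero): W̌_{rq,s'}(ℓ+m)·Ŵ_{rq,s}(m)·E₁·(μ_s x_s − μ_r x_r q^{2(m+1)}) = W̌_{r,s'}(ℓ+m)·Ŵ_{r,s}(m)·κ₀κ₁ μ_s q^{−ℓ}·(q² x_r y_r − x_s y_s)·(q^{2(1+ℓ+m)} x_r μ_r μ_{s'} − y_{s'}). -/
noncomputable section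

/-- The chiral Potts weight `Ŵ_{a,b}(m) = ∏_{j=1}^m (μ_b y_a − μ_a y_b q^{2(j−1)})/(μ_b x_b − μ_a x_a q^{2j})`,
for parameter triples `a = (x_a, y_a, μ_a)`, `b = (x_b, y_b, μ_b)`. -/
def What (q : ℂ) (a b : ℂ × ℂ × ℂ) (m : ℕ) : ℂ :=
  ∏ j ∈ Finset.range m,
    (b.2.2 * a.2.1 - a.2.2 * b.2.1 * q ^ (2 * j)) /
      (b.2.2 * b.1 - a.2.2 * a.1 * q ^ (2 * (j + 1)))

/-- The chiral Potts weight `W̌_{a,b}(n) = ∏_{j=1}^n (y_b − x_a μ_a μ_b q^{2j})/(y_a − x_b μ_a μ_b q^{2j})`. -/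
def Wcheck (q : ℂ) (a b : ℂ × ℂ × ℂ) (n : ℕ) : ℂ :=
  ∏ j ∈ Finset.range n,
    (b.2.1 - a.1 * a.2.2 * b.2.2 * q ^ (2 * (j + 1))) /
      (a.2.1 - b.1 * a.2.2 * b.2.2 * q ^ (2 * (j + 1)))

/-- Shifting the first parameter triple by `q` telescopes the numerators of `Wcheck`. -/
theorem Wcheck_shift_left {q : ℂ} (hq : q ≠ 0) (x y μ : ℂ) (b : ℂ × ℂ × ℂ) (n : ℕ) :
    Wcheck q (q * x, q * y, q * μ) b n * (q ^ 2 * x * μ * b.2.2 - b.2.1) * q ^ n =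
      Wcheck q (x, y, μ) b n * (q ^ (2 * (n + 1)) * x * μ * b.2.2 - b.2.1) := by
  induction n with
  | zero => simp [Wcheck]
  | succ n ih =>
    have hden : q * y - b.1 * (q * μ) * b.2.2 * q ^ (2 * (n + 1)) =
        q * (y - b.1 * μ * b.2.2 * q ^ (2 * (n + 1))) := by ring
    simp only [Wcheck, Finset.prod_range_succ] at ih ⊢
    have hfactor : (b.2.1 - q * x * (q * μ) * b.2.2 * q ^ (2 * (n + 1))) /
        (q * y - b.1 * (q * μ) * b.2.2 * q ^ (2 * (n + 1))) * q =
        (b.2.1 - q * x * (q * μ) * b.2.2 * q ^ (2 * (n + 1))) /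
          (y - b.1 * μ * b.2.2 * q ^ (2 * (n + 1))) := by
      rw [hden, mul_comm q (_ - _), ← div_div, div_mul_cancel₀ _ hq]
    rw [pow_succ q n, mul_right_comm _ (_ / _), mul_mul_mul_comm, hfactor, ih]
    ring

/-- Shifting the first parameter triple by `q` telescopes the denominators of `What`. -/
theorem What_shift_left {q x μ : ℂ} {b : ℂ × ℂ × ℂ} (y : ℂ)
    (hd : ∀ j : ℕ, b.2.2 * b.1 - μ * x * q ^ (2 * (j + 1)) ≠ 0) (m : ℕ) :
    What q (q * x, q * y, q * μ) b m * (b.2.2 * b.1 - μ * x * q ^ (2 * (m + 1))) =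
      q ^ m * What q (x, y, μ) b m * (b.2.2 * b.1 - μ * x * q ^ 2) := by
  induction m with
  | zero => simp [What]
  | succ m ih =>
    have hden : b.2.2 * b.1 - q * μ * (q * x) * q ^ (2 * (m + 1)) =
        b.2.2 * b.1 - μ * x * q ^ (2 * (m + 1 + 1)) := by ring
    have hm := hd m
    have hm' := hd (m + 1)
    simp only [What, Finset.prod_range_succ] at ih ⊢
    rw [hden, mul_assoc, div_mul_cancel₀ _ hm', ← mul_left_inj' hm]
    rw [mul_right_comm, ih]
    field_simp
    ring

/-- The core identity (eq:step4) of Proposition (Vfusion)(i), proved in the paper by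
double induction in `m` and `ℓ`. -/
theorem stmt_16 (q xr yr μr xs ys μs xs' ys' μs' κ₀ κ₁ : ℂ)
    (hq : q ≠ 0) (hxr : xr ≠ 0) (hyr : yr ≠ 0) (hμr : μr ≠ 0)
    (hxs : xs ≠ 0) (hys : ys ≠ 0) (hμs : μs ≠ 0)
    (hxs' : xs' ≠ 0) (hys' : ys' ≠ 0) (hμs' : μs' ≠ 0)
    (hκ₀ : κ₀ ≠ 0) (hκ₁ : κ₁ ≠ 0)
    (hd1 : ∀ j : ℕ, μs * xs - μr * xr * q ^ (2 * (j + 1)) ≠ 0)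
    (hd2 : ∀ j : ℕ, μs * xs - (q * μr) * (q * xr) * q ^ (2 * (j + 1)) ≠ 0)
    (hd3 : ∀ j : ℕ, yr - xs' * μr * μs' * q ^ (2 * (j + 1)) ≠ 0)
    (hd4 : ∀ j : ℕ, q * yr - xs' * (q * μr) * μs' * q ^ (2 * (j + 1)) ≠ 0)
    (m ℓ : ℕ) :
    Wcheck q (q * xr, q * yr, q * μr) (xs', ys', μs') (ℓ + m) *
        What q (q * xr, q * yr, q * μr) (xs, ys, μs) m *
        (μs * κ₀ * κ₁ * (q ^ 2 * xr * yr - xs * ys) *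
          (q ^ 2 * xr * μr * μs' - ys') / (μs * xs - μr * xr * q ^ 2)) *
        (μs * xs - μr * xr * q ^ (2 * (m + 1)))
      = Wcheck q (xr, yr, μr) (xs', ys', μs') (ℓ + m) *
        What q (xr, yr, μr) (xs, ys, μs) m *
        (κ₀ * κ₁ * μs * q ^ (-(ℓ : ℤ)) * (q ^ 2 * xr * yr - xs * ys) *
          (q ^ (2 * (1 + ℓ + m)) * xr * μr * μs' - ys')) := by
  have hcheck := Wcheck_shift_left hq xr yr μr (xs', ys', μs') (ℓ + m)
  have hhat := What_shift_left (b := (xs, ys, μs)) yr hd1 m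
  have hd := hd1 0
  simp only [zero_add, mul_one] at hd
  dsimp only at hcheck hhat
  rw [show 2 * (1 + ℓ + m) = 2 * (ℓ + m + 1) by ring, zpow_neg, zpow_natCast]
  generalize Wcheck q (q * xr, q * yr, q * μr) (xs', ys', μs') (ℓ + m) = A at *
  generalize What q (q * xr, q * yr, q * μr) (xs, ys, μs) m = B at *
  generalize Wcheck q (xr, yr, μr) (xs', ys', μs') (ℓ + m) = C at *
  generalize What q (xr, yr, μr) (xs, ys, μs) m = D at *
  generalize μs * xs - μr * xr * q ^ (2 * (m + 1)) = e at *
  generalize μs * xs - μr * xr * q ^ 2 = d at *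
  generalize q ^ (2 * (ℓ + m + 1)) * xr * μr * μs' - ys' = f at *
  generalize q ^ 2 * xr * μr * μs' - ys' = g at *
  rw [pow_add] at hcheck
  field_simp
  linear_combination (q ^ 2 * xr * yr - xs * ys) * (A * g * q ^ ℓ * hhat + D * d * hcheck)

end
end

section
/- Let q, x_r, y_r, μ_r, x_s, y_s, μ_s, x_{s'}, y_{s'}, μ_{s'}, κ₀, κ₁ be nonzero complex numbers. For integers m ≥ 0, n ≥ 0, define Ŵ_{a,b}(m) := ∏_{j=1}^{m} (μ_b y_a − μ_a y_b q^{2(j−1)})/(μ_b x_b − μ_a x_a q^{2j}) and W̌_{a,b}(n) := ∏_{j=1}^{n} (y_b − x_a μ_a μ_b q^{2j})/(y_a − x_b μ_a μ_b q^{2j}), for parameter triples a = (x_a,y_a,μ_a), b = (x_b,y_b,μ_b); write rq⁻¹ := (q⁻¹ x_r, q⁻¹ y_r, q⁻¹ μ_r). Set E₂ := μ_{s'} q² κ₀κ₁ (x_r y_r − x_{s'} y_{s'})(x_r μ_r − x_s μ_s)/(y_{s'} − x_r μ_r μ_{s'}). Then for all integers m, ℓ ≥ 0 (assuming every factor appearing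 in a denominator is nonzero): W̌_{rq⁻¹,s'}(m+ℓ)·Ŵ_{rq⁻¹,s}(m)·E₂·(y_{s'} − x_r μ_r μ_{s'} q^{2(m+ℓ)}) = W̌_{r,s'}(m+ℓ)·Ŵ_{r,s}(m)·μ_{s'} κ₀κ₁ q^{2+ℓ}·(x_r y_r − x_{s'} y_{s'})·(q^{2m} x_r μ_r − x_s μ_s). -/
noncomputable section

/-- Effect on `W̌_{a,b}(n)` of the shift `a ↦ a q⁻¹`. -/
theorem Wcheck_shift_mul (q x y μ : ℂ) (b : ℂ × ℂ × ℂ) (hq : q ≠ 0) (n : ℕ) :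
    Wcheck q (q⁻¹ * x, q⁻¹ * y, q⁻¹ * μ) b n * (b.2.1 - x * μ * b.2.2 * q ^ (2 * n))
      = q ^ n * Wcheck q (x, y, μ) b n * (b.2.1 - x * μ * b.2.2) := by
  induction n with
  | zero => simp [Wcheck]
  | succ n ih =>
    simp only [Wcheck, Finset.prod_range_succ] at ih ⊢
    have hnum : b.2.1 - q⁻¹ * x * (q⁻¹ * μ) * b.2.2 * q ^ (2 * (n + 1))
        = b.2.1 - x * μ * b.2.2 * q ^ (2 * n) := by
      field_simp
      ring
    have hden : q⁻¹ * y - b.1 * (q⁻¹ * μ) * b.2.2 * q ^ (2 * (n + 1))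
        = q⁻¹ * (y - b.1 * μ * b.2.2 * q ^ (2 * (n + 1))) := by
      ring
    rw [hnum, hden, div_eq_mul_inv, div_eq_mul_inv, mul_inv, inv_inv]
    linear_combination q * (y - b.1 * μ * b.2.2 * q ^ (2 * (n + 1)))⁻¹ *
      (b.2.1 - x * μ * b.2.2 * q ^ (2 * (n + 1))) * ih

/-- Effect on `Ŵ_{a,b}(m)` of the shift `a ↦ a q⁻¹`. -/
theorem pow_mul_What_shift_mul (q x y μ : ℂ) (b : ℂ × ℂ × ℂ) (hq : q ≠ 0)
    (hd : ∀ j : ℕ, b.2.2 * b.1 - μ * x * q ^ (2 * j) ≠ 0) (m : ℕ) :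
    q ^ m * What q (q⁻¹ * x, q⁻¹ * y, q⁻¹ * μ) b m * (b.2.2 * b.1 - μ * x)
      = What q (x, y, μ) b m * (b.2.2 * b.1 - μ * x * q ^ (2 * m)) := by
  induction m with
  | zero => simp [What]
  | succ m ih =>
    simp only [What, Finset.prod_range_succ] at ih ⊢
    have hnum : b.2.2 * (q⁻¹ * y) - q⁻¹ * μ * b.2.1 * q ^ (2 * m)
        = q⁻¹ * (b.2.2 * y - μ * b.2.1 * q ^ (2 * m)) := by
      ring
    have hden : b.2.2 * b.1 - q⁻¹ * μ * (q⁻¹ * x) * q ^ (2 * (m + 1))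
        = b.2.2 * b.1 - μ * x * q ^ (2 * m) := by
      field_simp
      ring
    have h₀ := inv_mul_cancel₀ (hd m)
    have h₁ := inv_mul_cancel₀ (hd (m + 1))
    have h₂ := mul_inv_cancel₀ hq
    rw [hnum, hden, div_eq_mul_inv, div_eq_mul_inv]
    generalize (∏ j ∈ Finset.range m, (b.2.2 * y - μ * b.2.1 * q ^ (2 * j)) /
      (b.2.2 * b.1 - μ * x * q ^ (2 * (j + 1)))) = P at ih ⊢
    generalize b.2.2 * y - μ * b.2.1 * q ^ (2 * m) = N
    generalize b.2.2 * b.1 - μ * x * q ^ (2 * m) = D₀ at *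
    generalize b.2.2 * b.1 - μ * x * q ^ (2 * (m + 1)) = D₁ at *
    linear_combination q * q⁻¹ * N * D₀⁻¹ * ih + q * q⁻¹ * N * P * h₀ + N * P * h₂ - N * P * h₁

/-- The core identity of Proposition (Vfusion)(ii) (the reduction of (eq:id9)),
proved in the paper by double induction in `m` and `ℓ`. -/
theorem stmt_17 (q xr yr μr xs ys μs xs' ys' μs' κ₀ κ₁ : ℂ)
    (hq : q ≠ 0) (hxr : xr ≠ 0) (hyr : yr ≠ 0) (hμr : μr ≠ 0)
    (hxs : xs ≠ 0) (hys : ys ≠ 0) (hμs : μs ≠ 0)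
    (hxs' : xs' ≠ 0) (hys' : ys' ≠ 0) (hμs' : μs' ≠ 0)
    (hκ₀ : κ₀ ≠ 0) (hκ₁ : κ₁ ≠ 0)
    (hd1 : ∀ j : ℕ, μs * xs - μr * xr * q ^ (2 * (j + 1)) ≠ 0)
    (hd2 : ∀ j : ℕ, μs * xs - (q⁻¹ * μr) * (q⁻¹ * xr) * q ^ (2 * (j + 1)) ≠ 0)
    (hd3 : ∀ j : ℕ, yr - xs' * μr * μs' * q ^ (2 * (j + 1)) ≠ 0)
    (hd4 : ∀ j : ℕ, q⁻¹ * yr - xs' * (q⁻¹ * μr) * μs' * q ^ (2 * (j + 1)) ≠ 0)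
    (hd5 : ys' - xr * μr * μs' ≠ 0)
    (m ℓ : ℕ) :
    Wcheck q (q⁻¹ * xr, q⁻¹ * yr, q⁻¹ * μr) (xs', ys', μs') (m + ℓ) *
        What q (q⁻¹ * xr, q⁻¹ * yr, q⁻¹ * μr) (xs, ys, μs) m *
        (μs' * q ^ 2 * κ₀ * κ₁ * (xr * yr - xs' * ys') * (xr * μr - xs * μs) /
          (ys' - xr * μr * μs')) *
        (ys' - xr * μr * μs' * q ^ (2 * (m + ℓ)))
      = Wcheck q (xr, yr, μr) (xs', ys', μs') (m + ℓ) *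
        What q (xr, yr, μr) (xs, ys, μs) m *
        (μs' * κ₀ * κ₁ * q ^ (2 + ℓ) * (xr * yr - xs' * ys') *
          (q ^ (2 * m) * xr * μr - xs * μs)) := by
  have hd (j : ℕ) : μs * xs - μr * xr * q ^ (2 * j) ≠ 0 := by
    have h := hd2 j
    rwa [show q⁻¹ * μr * (q⁻¹ * xr) * q ^ (2 * (j + 1)) = μr * xr * q ^ (2 * j) by
      field_simp
      ring] at h
  have hC := Wcheck_shift_mul q xr yr μr (xs', ys', μs') hq (m + ℓ)
  have hH := pow_mul_What_shift_mul q xr yr μr (xs, ys, μs) hq hd m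
  simp only at hC hH
  rw [mul_div_assoc', div_mul_eq_mul_div, div_eq_iff hd5]
  linear_combination
    μs' * q ^ 2 * κ₀ * κ₁ * (xr * yr - xs' * ys') * (xr * μr - xs * μs) *
      What q (q⁻¹ * xr, q⁻¹ * yr, q⁻¹ * μr) (xs, ys, μs) m * hC -
    q ^ ℓ * Wcheck q (xr, yr, μr) (xs', ys', μs') (m + ℓ) * (ys' - xr * μr * μs') *
      μs' * q ^ 2 * κ₀ * κ₁ * (xr * yr - xs' * ys') * hH

end
end
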